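/- arXiv:1501.05873 — 8 statements merged into one kernel-verified Lean document; each statement's English description precedes it below -/
import Mathlib

section
/- Let α > 0 and let ν be a symmetric probability measure on ℝ with ν({0}) = 0, with cumulative distribution function F(t) = ν((−∞,t]), and let G(t) = ∫_ℝ (1 − |x/t|^α)₊ ν(dx) for t > 0. Then for every t > 0 one has 2α ∫₀ᵗ x^{α−1} F(x) dx = t^α (G(t) + 1). -/
open MeasureTheory

/-- `Ψ(t) = (1 - |t|^α)₊`. -/
noncomputable def Psi (α t : ℝ) : ℝ := max (1 - |t| ^ α) 0

/-- The Williamson transform of a measure on `ℝ`. -/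
noncomputable def williamson (α : ℝ) (ν : Measure ℝ) (t : ℝ) : ℝ :=
  ∫ x, Psi α (x * t) ∂ν

/-- A measure on `ℝ` is symmetric if it is invariant under `x ↦ -x`. -/
def IsSymmetric (ν : Measure ℝ) : Prop := ν.map (fun x => -x) = ν

/-- The rescaling operator `T_a`: `(T_a λ)(A) = λ(A / a)` for `a ≠ 0`, `T_0 λ = δ_0`. -/
noncomputable def rescale (a : ℝ) (μ : Measure ℝ) : Measure ℝ :=
  if a = 0 then Measure.dirac 0 else μ.map (fun x => a * x)

/-- `δ̃_x = (δ_x + δ_{-x})/2`. -/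
noncomputable def deltaTilde (x : ℝ) : Measure ℝ :=
  (2 : ENNReal)⁻¹ • (Measure.dirac x + Measure.dirac (-x))

/-- The symmetric Pareto measure `π̃_{2α}` with density `α |y|^{-2α-1} 1_{|y| ≥ 1}`. -/
noncomputable def pareto (α : ℝ) : Measure ℝ :=
  volume.withDensity fun y =>
    ENNReal.ofReal (if 1 ≤ |y| then α * |y| ^ (-2 * α - 1) else 0)

/-- Kendall convolution of two symmetric two-point masses:
`δ̃_x ▵_α δ̃_y = T_M (ϱ^α π̃_{2α} + (1 - ϱ^α) δ̃_1)`. -/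
noncomputable def kendallPoint (α x y : ℝ) : Measure ℝ :=
  let M := max |x| |y|
  let m := min |x| |y|
  let ρ := if M = 0 then 0 else m / M
  rescale M (ENNReal.ofReal (ρ ^ α) • pareto α +
    ENNReal.ofReal (1 - ρ ^ α) • deltaTilde 1)

/-- Kendall convolution of two measures on `ℝ`:
`(ν₁ ▵_α ν₂)(A) = ∫∫ (δ̃_x ▵_α δ̃_y)(A) ν₁(dx) ν₂(dy)`. -/
noncomputable def kendall (α : ℝ) (ν₁ ν₂ : Measure ℝ) : Measure ℝ :=
  ν₁.bind fun x => ν₂.bind fun y => kendallPoint α x y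

/-- `n`-fold Kendall convolution power `ν^{▵_α n}`. -/
noncomputable def kendallPow (α : ℝ) (ν : Measure ℝ) : ℕ → Measure ℝ
  | 0 => Measure.dirac 0
  | 1 => ν
  | n + 2 => kendall α (kendallPow α ν (n + 1)) ν

/-- The one-step kernel of the Kendall random walk: `K(x, ·) = δ̃_x ▵_α ν`. -/
noncomputable def kendallKernel (α : ℝ) (ν : Measure ℝ) (x : ℝ) : Measure ℝ :=
  ν.bind fun y => kendallPoint α x y

/-- `excursion α ν n` is the sub-probability distribution of `X_{n+1}` on the event
`X₁ ≤ 0, …, X_n ≤ 0` for the Kendall random walk started at `0`, so that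
`Φ_{n+1}(t) = excursion α ν n ((0,t))`. -/
noncomputable def excursion (α : ℝ) (ν : Measure ℝ) : ℕ → Measure ℝ
  | 0 => ν
  | n + 1 => ((excursion α ν n).restrict (Set.Iic 0)).bind (kendallKernel α ν)

/-- The inner integral in the Fubini argument. -/
theorem inner_integral_aux (α : ℝ) (hα : 0 < α) (t : ℝ) (ht : 0 < t) (y : ℝ) :
    ∫ x in Set.Ioc 0 t, (if y ≤ x then x ^ (α - 1) else 0) =
      (t ^ α - (min (max y 0) t) ^ α) / α := by
  have h1 : (fun x : ℝ => if y ≤ x then x ^ (α - 1) else 0) =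
      (Set.Ici y).indicator (fun x : ℝ => x ^ (α - 1)) := by
    ext x
    simp [Set.indicator_apply]
  rw [h1, setIntegral_indicator measurableSet_Ici]
  have key : ∀ c : ℝ, c ≤ t → ∫ x in Set.Ioc c t, x ^ (α - 1) = (t ^ α - c ^ α) / α := by
    intro c hc
    rw [← intervalIntegral.integral_of_le hc, integral_rpow (Or.inl (by linarith))]
    simp
  rcases le_or_gt y 0 with hy | hy
  · have : Set.Ioc 0 t ∩ Set.Ici y = Set.Ioc 0 t := by
      ext x
      simp only [Set.mem_inter_iff, Set.mem_Ioc, Set.mem_Ici]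
      constructor
      · exact fun h => h.1
      · exact fun h => ⟨h, by linarith [h.1]⟩
    rw [this, max_eq_right hy, min_eq_left ht.le, key 0 ht.le]
  · have : Set.Ioc 0 t ∩ Set.Ici y = Set.Icc y t := by
      ext x
      simp only [Set.mem_inter_iff, Set.mem_Ioc, Set.mem_Ici, Set.mem_Icc]
      constructor
      · exact fun h => ⟨h.2, h.1.2⟩
      · exact fun h => ⟨⟨by linarith [h.1], h.2⟩, h.1⟩
    rw [this, max_eq_left hy.le]
    rcases le_or_gt y t with hyt | hyt
    · rw [min_eq_left hyt, integral_Icc_eq_integral_Ioc, key y hyt]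
    · rw [min_eq_right hyt.le, Set.Icc_eq_empty (not_le.mpr hyt)]
      simp

theorem sym_sum_aux (α : ℝ) (hα : 0 < α) (t : ℝ) (ht : 0 < t) (y : ℝ) :
    (t ^ α - (min (max y 0) t) ^ α) / α + (t ^ α - (min (max (-y) 0) t) ^ α) / α =
      t ^ α / α * (max (1 - |y / t| ^ α) 0 + 1) := by
  wlog hy : 0 ≤ y generalizing y with H
  · have := H (-y) (by linarith)
    rw [neg_neg, neg_div, abs_neg] at this
    rw [← this, add_comm]
  have ha : t ^ α ≠ 0 := (Real.rpow_pos_of_pos ht α).ne'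
  rw [max_eq_left hy, max_eq_right (by linarith : -y ≤ 0), min_eq_left ht.le,
    Real.zero_rpow hα.ne', abs_of_nonneg (div_nonneg hy ht.le)]
  rcases le_or_gt y t with hyt | hyt
  · have h1 : (y / t) ^ α ≤ 1 :=
      Real.rpow_le_one (div_nonneg hy ht.le) ((div_le_one ht).mpr hyt) hα.le
    rw [min_eq_left hyt, max_eq_left (by linarith), Real.div_rpow hy ht.le]
    field_simp
    ring
  · have h1 : 1 ≤ (y / t) ^ α :=
      Real.one_le_rpow ((one_le_div ht).mpr hyt.le) hα.le
    rw [min_eq_right hyt.le, max_eq_right (by linarith)]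
    ring

/-- If `ν` is a symmetric probability measure on `ℝ` with `ν({0}) = 0`, `F` its CDF and
`G(t) = ∫ (1 - |x/t|^α)₊ ν(dx)`, then `2α ∫₀ᵗ x^{α-1} F(x) dx = t^α (G(t) + 1)` for `t > 0`. -/
theorem williamson_integral_identity (α : ℝ) (hα : 0 < α)
    (ν : Measure ℝ) [IsProbabilityMeasure ν] (hsym : IsSymmetric ν) (h0 : ν {0} = 0)
    (F G : ℝ → ℝ)
    (hF : ∀ t : ℝ, F t = (ν (Set.Iic t)).toReal)
    (hG : ∀ t : ℝ, 0 < t → G t = ∫ x, max (1 - |x / t| ^ α) 0 ∂ν)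
    (t : ℝ) (ht : 0 < t) :
    2 * α * ∫ x in (0 : ℝ)..t, x ^ (α - 1) * F x = t ^ α * (G t + 1) := by
  have hint0 : Integrable (fun x : ℝ => x ^ (α - 1)) (volume.restrict (Set.Ioc 0 t)) := by
    have := intervalIntegral.intervalIntegrable_rpow' (a := 0) (b := t)
      (by linarith : -1 < α - 1)
    exact (intervalIntegrable_iff_integrableOn_Ioc_of_le ht.le).mp this
  have hint : Integrable (Function.uncurry fun (x y : ℝ) => if y ≤ x then x ^ (α - 1) else 0)
      ((volume.restrict (Set.Ioc 0 t)).prod ν) := by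
    have h1 : Integrable (fun p : ℝ × ℝ => p.1 ^ (α - 1))
        ((volume.restrict (Set.Ioc 0 t)).prod ν) := hint0.comp_fst ν
    have h2 : MeasurableSet {p : ℝ × ℝ | p.2 ≤ p.1} :=
      measurableSet_le measurable_snd measurable_fst
    refine (h1.indicator h2).congr (Filter.Eventually.of_forall fun p => ?_)
    simp [Set.indicator_apply, Function.uncurry]
  have hswap := integral_integral_swap hint
  have hI : ∫ x in (0 : ℝ)..t, x ^ (α - 1) * F x =
      ∫ y, (t ^ α - (min (max y 0) t) ^ α) / α ∂ν := by
    rw [intervalIntegral.integral_of_le ht.le]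
    simp_rw [inner_integral_aux α hα t ht] at hswap
    rw [← hswap]
    congr 1
    ext x
    have : (fun y : ℝ => if y ≤ x then x ^ (α - 1) else 0) =
        (Set.Iic x).indicator (fun _ : ℝ => x ^ (α - 1)) := by
      ext y
      simp [Set.indicator_apply]
    rw [this, integral_indicator_const _ measurableSet_Iic, hF, smul_eq_mul, mul_comm]
    rfl
  have hH : Integrable (fun y : ℝ => (t ^ α - (min (max y 0) t) ^ α) / α) ν := by
    have := hint.integral_prod_right
    simp only [Function.uncurry] at this
    simpa only [inner_integral_aux α hα t ht] using this
  have hmp : MeasurePreserving (fun x : ℝ => -x) ν ν := ⟨measurable_neg, hsym⟩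
  have hH' : Integrable (fun y : ℝ => (t ^ α - (min (max (-y) 0) t) ^ α) / α) ν :=
    hmp.integrable_comp_of_integrable hH
  have hneg : ∫ y, (t ^ α - (min (max (-y) 0) t) ^ α) / α ∂ν =
      ∫ y, (t ^ α - (min (max y 0) t) ^ α) / α ∂ν :=
    hmp.integral_comp (MeasurableEquiv.neg ℝ).measurableEmbedding
      (fun y : ℝ => (t ^ α - (min (max y 0) t) ^ α) / α)
  have hsum := integral_add hH hH'
  simp_rw [sym_sum_aux α hα t ht] at hsum
  have hGi : Integrable (fun x : ℝ => max (1 - |x / t| ^ α) 0) ν := by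
    refine Integrable.of_bound (C := 1)
      (Measurable.aestronglyMeasurable (by measurability)) (Filter.Eventually.of_forall fun x => ?_)
    have : 0 ≤ |x / t| ^ α := by positivity
    rw [Real.norm_of_nonneg (le_max_right _ _)]
    exact max_le (by linarith) zero_le_one
  rw [integral_const_mul, integral_add hGi (integrable_const _), ← hG t ht, hneg, ← hI] at hsum
  simp only [integral_const, probReal_univ, smul_eq_mul, mul_one] at hsum
  have h2 : 2 * α * ∫ x in (0 : ℝ)..t, x ^ (α - 1) * F x =
      α * (t ^ α / α * (G t + 1)) := by
    rw [hsum]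
    ring
  rw [h2]
  field_simp
end

section
/- Let α > 0 and let ν be a symmetric probability measure on ℝ with ν({0}) = 0, with cumulative distribution function F(t) = ν((−∞,t]), and let G(t) = ∫_ℝ (1 − |x/t|^α)₊ ν(dx) for t > 0. Then at every t > 0 at which F is continuous, G is differentiable at t and F(t) = (1/(2α)) [ α (G(t) + 1) + t G′(t) ]. -/
open MeasureTheory

lemma aux_lip (α : ℝ) (hα : 0 < α) (x a b m : ℝ) (hm : 0 < m) (ha : m < a) (hab : a ≤ b) :
    |max (1 - |x / b| ^ α) 0 - max (1 - |x / a| ^ α) 0| ≤ α / m * (b - a) := by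
  have ha0 : 0 < a := hm.trans ha
  have hb0 : 0 < b := ha0.trans_le hab
  set u := |x / a| ^ α with hu
  have hu0 : 0 ≤ u := by positivity
  set r := (a / b) ^ α with hr
  have hr0 : 0 ≤ r := by positivity
  have hr1 : r ≤ 1 := Real.rpow_le_one (by positivity) ((div_le_one hb0).2 hab) hα.le
  have hub : |x / b| ^ α = u * r := by
    rw [hu, hr, ← Real.mul_rpow (abs_nonneg _) (by positivity)]
    congr 1
    rw [abs_div, abs_div, abs_of_pos ha0, abs_of_pos hb0]
    field_simp
  have hlog : 1 - r ≤ α / m * (b - a) := by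
    have h1 : r = Real.exp (Real.log (a / b) * α) := Real.rpow_def_of_pos (by positivity) α
    have h2 := Real.add_one_le_exp (Real.log (a / b) * α)
    have h3 : Real.log (b / a) ≤ b / a - 1 := Real.log_le_sub_one_of_pos (by positivity)
    have h4 : Real.log (a / b) = - Real.log (b / a) := by
      rw [← Real.log_inv, inv_div]
    have h5 : b / a - 1 ≤ (b - a) / m := by
      have : b / a - 1 = (b - a) / a := by field_simp
      rw [this]
      exact div_le_div_of_nonneg_left (by linarith) hm ha.le
    have h6 : 1 - r ≤ Real.log (b / a) * α := by rw [h1]; rw [h4] at h2 ⊢; linarith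
    have h7 : Real.log (b / a) * α ≤ (b - a) / m * α :=
      mul_le_mul_of_nonneg_right (h3.trans h5) hα.le
    calc _ ≤ _ := h6.trans h7
      _ = _ := by ring
  refine le_trans ?_ hlog
  rw [hub]
  have hle : u * r ≤ u := mul_le_of_le_one_right hu0 hr1
  rcases le_total u 1 with h | h
  · rw [max_eq_left (by linarith), max_eq_left (by linarith), abs_of_nonneg (by linarith)]
    nlinarith
  · rw [max_eq_right (a := 1 - u) (by linarith), sub_zero, abs_of_nonneg (le_max_right _ _)]
    apply max_le <;> nlinarith

lemma aux_deriv (α : ℝ) (hα : 0 < α) (x t : ℝ) (ht : 0 < t) (hx : |x| ≠ t) :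
    HasDerivAt (fun s => max (1 - |x / s| ^ α) 0)
      (if |x| < t then α / t * |x / t| ^ α else 0) t := by
  rcases lt_or_gt_of_ne hx with h | h
  · rw [if_pos h]
    have h1 : HasDerivAt (fun s : ℝ => 1 - |x| ^ α * s ^ (-α))
        (-(|x| ^ α * (-α * t ^ (-α - 1)))) t :=
      ((Real.hasDerivAt_rpow_const (Or.inl ht.ne')).const_mul _).const_sub 1
    have h2 : -(|x| ^ α * (-α * t ^ (-α - 1))) = α / t * |x / t| ^ α := by
      rw [abs_div, abs_of_pos ht, Real.div_rpow (abs_nonneg _) ht.le, Real.rpow_sub_one ht.ne',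
        Real.rpow_neg ht.le]
      field_simp
    rw [h2] at h1
    refine h1.congr_of_eventuallyEq ?_
    filter_upwards [lt_mem_nhds h] with s hs
    have hs0 : 0 < s := (abs_nonneg x).trans_lt hs
    have h3 : |x / s| ^ α ≤ 1 := by
      refine Real.rpow_le_one (abs_nonneg _) ?_ hα.le
      rw [abs_div, abs_of_pos hs0]; exact (div_le_one hs0).2 hs.le
    rw [max_eq_left (by linarith), abs_div, abs_of_pos hs0, Real.div_rpow (abs_nonneg _) hs0.le,
      Real.rpow_neg hs0.le, div_eq_mul_inv]
  · rw [if_neg h.not_gt]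
    refine (hasDerivAt_const t (0 : ℝ)).congr_of_eventuallyEq ?_
    filter_upwards [gt_mem_nhds h, lt_mem_nhds ht] with s hs hs0
    have h3 : 1 ≤ |x / s| ^ α := by
      refine Real.one_le_rpow ?_ hα.le
      rw [abs_div, abs_of_pos hs0]; exact (one_le_div hs0).2 hs.le
    exact max_eq_right (by linarith)

lemma aux_int (α : ℝ) (ν : Measure ℝ) [IsProbabilityMeasure ν] (t : ℝ) :
    Integrable (fun x => max (1 - |x / t| ^ α) 0) ν := by
  refine Integrable.of_bound (C := 1) (Measurable.aestronglyMeasurable (by fun_prop)) (.of_forall fun x => ?_)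
  rw [Real.norm_eq_abs, abs_of_nonneg (le_max_right _ _)]
  have : 0 ≤ |x / t| ^ α := by positivity
  exact max_le (by linarith) zero_le_one

/-- Inversion of the Williamson transform: at every `t > 0` at which the CDF `F` of `ν` is
continuous, `G` is differentiable at `t` and
`F(t) = (1/(2α)) [α (G(t) + 1) + t G'(t)]`. -/
theorem williamson_inversion (α : ℝ) (hα : 0 < α)
    (ν : Measure ℝ) [IsProbabilityMeasure ν] (hsym : IsSymmetric ν) (h0 : ν {0} = 0)
    (F G : ℝ → ℝ)
    (hF : ∀ t : ℝ, F t = (ν (Set.Iic t)).toReal)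
    (hG : ∀ t : ℝ, G t = ∫ x, max (1 - |x / t| ^ α) 0 ∂ν)
    (t : ℝ) (ht : 0 < t) (hcont : ContinuousAt F t) :
    ∃ d : ℝ, HasDerivAt G d t ∧
      F t = (1 / (2 * α)) * (α * (G t + 1) + t * d) := by
  -- no atom at `t`
  have hat : ν.real {t} = 0 := by
    have hl : Filter.Tendsto (fun s => F t - F s) (nhdsWithin t (Set.Iio t)) (nhds (F t - F t)) :=
      tendsto_const_nhds.sub (hcont.tendsto.mono_left nhdsWithin_le_nhds)
    rw [sub_self] at hl
    refine le_antisymm (ge_of_tendsto hl ?_) measureReal_nonneg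
    filter_upwards [self_mem_nhdsWithin] with s hs
    have hs : s < t := hs
    have h1 : ν.real (Set.Iic s ∪ {t}) = ν.real (Set.Iic s) + ν.real {t} :=
      measureReal_union (by simpa using hs) (measurableSet_singleton t)
    have h2 : ν.real (Set.Iic s ∪ {t}) ≤ ν.real (Set.Iic t) :=
      measureReal_mono (by
        rintro y (hy | hy)
        · exact le_trans hy hs.le
        · exact le_of_eq hy)
    rw [hF, hF]
    change _ ≤ ν.real _ - ν.real _
    linarith
  have hrefl : ∀ A : Set ℝ, MeasurableSet A → ν.real ((fun x => -x) ⁻¹' A) = ν.real A := by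
    intro A hA
    have : ν A = ν ((fun x => -x) ⁻¹' A) := by
      conv_lhs => rw [← (show ν.map (fun x => -x) = ν from hsym)]
      exact Measure.map_apply measurable_neg hA
    simp only [measureReal_def, this]
  have hat' : ν.real {-t} = 0 := by
    rw [← hat, ← hrefl {t} (measurableSet_singleton t)]
    congr 1; ext y; simp [neg_eq_iff_eq_neg]
  have hset : MeasurableSet {x : ℝ | |x| < t} := measurableSet_lt (by fun_prop) (by fun_prop)
  have hFt : F t = 1 / 2 * (1 + ν.real {x : ℝ | |x| < t}) := by
    have e1 : ν.real (Set.Iic t) + ν.real (Set.Ioi t) = 1 := by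
      rw [← Set.compl_Iic, measureReal_add_measureReal_compl measurableSet_Iic]; simp
    have e2 : ν.real (Set.Iio (-t)) = ν.real (Set.Ioi t) := by
      rw [← hrefl _ measurableSet_Ioi]
      congr 1; ext y; simp [lt_neg]
    have e3 : ν.real (Set.Iic t) =
        ν.real (Set.Iio (-t)) + ν.real {-t} + ν.real {x : ℝ | |x| < t} + ν.real {t} := by
      rw [← measureReal_union _ (measurableSet_singleton _), ← measureReal_union _ hset,
        ← measureReal_union _ (measurableSet_singleton _)]
      · congr 1
        ext y
        simp only [Set.mem_Iic, Set.mem_union, Set.mem_Iio, Set.mem_singleton_iff,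
          Set.mem_setOf_eq, abs_lt]
        grind
      · simp; constructor <;> linarith [le_abs_self t]
      · rw [Set.disjoint_left]
        intro y hy
        simp only [Set.mem_union, Set.mem_Iio, Set.mem_singleton_iff,
          Set.mem_setOf_eq, abs_lt] at *
        grind
      · simp
    rw [hF]
    change ν.real _ = _
    linarith
  have hne : ∀ᵐ x ∂ν, |x| ≠ t := by
    have a1 : ∀ᵐ x ∂ν, x ≠ t := by
      have : ν {t} = 0 := (measureReal_eq_zero_iff).1 hat
      exact compl_mem_ae_iff.2 this
    have a2 : ∀ᵐ x ∂ν, x ≠ -t := by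
      have : ν {-t} = 0 := (measureReal_eq_zero_iff).1 hat'
      exact compl_mem_ae_iff.2 this
    filter_upwards [a1, a2] with x h1 h2 h
    rcases eq_or_eq_neg_of_abs_eq h with h | h
    · exact h1 h
    · exact h2 h
  have key := hasDerivAt_integral_of_dominated_loc_of_lip (μ := ν) (𝕜 := ℝ)
    (F := fun s x => max (1 - |x / s| ^ α) 0)
    (F' := fun x => if |x| < t then α / t * |x / t| ^ α else 0)
    (x₀ := t) (s := Set.Ioi (t / 2)) (bound := fun _ => α / (t / 2))
    (Ioi_mem_nhds (by linarith)) (.of_forall fun s => Measurable.aestronglyMeasurable (by fun_prop)) (aux_int α ν t)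
    (Measurable.aestronglyMeasurable (Measurable.ite hset (by fun_prop) (by fun_prop)))
    (.of_forall fun x => by
      refine LipschitzOnWith.of_dist_le_mul fun a ha b hb => ?_
      have hm : 0 < t / 2 := by linarith
      have hK : ((Real.nnabs (α / (t / 2)) : NNReal) : ℝ) = α / (t / 2) := by
        rw [Real.coe_nnabs, abs_of_pos (by positivity)]
      rw [hK, Real.dist_eq, Real.dist_eq]
      rcases le_total a b with h | h
      · rw [abs_sub_comm, abs_sub_comm a b, abs_of_nonneg (sub_nonneg.2 h)]
        exact aux_lip α hα x a b _ hm ha h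
      · rw [abs_of_nonneg (sub_nonneg.2 h)]
        exact aux_lip α hα x b a _ hm hb h)
    (integrable_const _)
    (hne.mono fun x hx => aux_deriv α hα x t ht hx)
  obtain ⟨hint, hder⟩ := key
  refine ⟨_, by rw [funext hG]; exact hder, ?_⟩
  have hsum : α * G t + t * ∫ x, (if |x| < t then α / t * |x / t| ^ α else 0) ∂ν
      = α * ν.real {x : ℝ | |x| < t} := by
    rw [hG, ← integral_const_mul, ← integral_const_mul,
      ← integral_add ((aux_int α ν t).const_mul _) (hint.const_mul _),
      ← integral_indicator_one hset, ← integral_const_mul]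
    congr 1
    ext x
    by_cases h : |x| < t
    · have h3 : |x / t| ^ α ≤ 1 := by
        refine Real.rpow_le_one (abs_nonneg _) ?_ hα.le
        rw [abs_div, abs_of_pos ht]; exact (div_le_one ht).2 h.le
      rw [if_pos h, Set.indicator_of_mem (by exact h), max_eq_left (by linarith)]
      simp only [Pi.one_apply]
      field_simp
      ring
    · have h3 : 1 ≤ |x / t| ^ α := by
        refine Real.one_le_rpow ?_ hα.le
        rw [abs_div, abs_of_pos ht]; exact (one_le_div ht).2 (not_lt.1 h)
      rw [if_neg h, Set.indicator_of_notMem (by exact h), max_eq_right (by linarith)]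
      simp
  have e : ∀ d : ℝ, α * (G t + 1) + t * d = (α * G t + t * d) + α := fun d => by ring
  rw [e, hsum, hFt]
  field_simp
  ring
end

section
/- Let α > 0. The Williamson transform is injective on symmetric probability measures: if ν₁ and ν₂ are symmetric probability measures on ℝ with ∫_ℝ (1 − |xt|^α)₊ ν₁(dx) = ∫_ℝ (1 − |xt|^α)₊ ν₂(dx) for every t > 0, then ν₁ = ν₂. -/
open MeasureTheory

lemma wi_trunc (α : ℝ) (hα : 0 < α) (ν : Measure ℝ) (u : ℝ) (hu : 0 < u) :
    ∫ x, max (u - |x| ^ α) 0 ∂ν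
      = u * ∫ x, max (1 - |x * u ^ (-α⁻¹)| ^ α) 0 ∂ν := by
  rw [← integral_const_mul]
  congr 1
  funext x
  have ht : 0 < u ^ (-α⁻¹) := Real.rpow_pos_of_pos hu _
  have e : |x * u ^ (-α⁻¹)| ^ α = |x| ^ α * u⁻¹ := by
    rw [abs_mul, abs_of_pos ht, Real.mul_rpow (abs_nonneg _) ht.le, ← Real.rpow_mul hu.le]
    have : -α⁻¹ * α = -1 := by field_simp
    rw [this, Real.rpow_neg_one]
  rw [e, mul_max_of_nonneg _ _ hu.le, mul_zero]
  congr 1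
  field_simp

lemma wi_integrable (α : ℝ) (hα : 0 < α) (ν : Measure ℝ) [IsProbabilityMeasure ν] (u : ℝ) :
    Integrable (fun x => max (u - |x| ^ α) 0) ν := by
  have hc : Continuous (fun x : ℝ => max (u - |x| ^ α) 0) := by
    have : Continuous (fun x : ℝ => |x| ^ α) :=
      continuous_abs.rpow_const (fun _ => Or.inr hα.le)
    fun_prop
  refine Integrable.of_bound hc.aestronglyMeasurable |u| (Filter.Eventually.of_forall fun x => ?_)
  have h0 : 0 ≤ |x| ^ α := Real.rpow_nonneg (abs_nonneg _) _
  rw [Real.norm_of_nonneg (le_max_right _ _)]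
  exact max_le (by linarith [le_abs_self u]) (abs_nonneg _)

lemma wi_tendsto (α : ℝ) (hα : 0 < α) (ν : Measure ℝ) [IsProbabilityMeasure ν] (u : ℝ)
    (hu : 0 < u) :
    Filter.Tendsto (fun n : ℕ => (∫ x, max (u - |x| ^ α) 0 ∂ν
        - ∫ x, max (u - u / (n + 2) - |x| ^ α) 0 ∂ν) / (u / (n + 2)))
      Filter.atTop (nhds (ν.real {x | |x| ^ α < u})) := by
  have hcα : Continuous (fun x : ℝ => |x| ^ α) :=
    continuous_abs.rpow_const (fun _ => Or.inr hα.le)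
  have hm : MeasurableSet {x : ℝ | |x| ^ α < u} :=
    measurableSet_lt hcα.measurable measurable_const
  rw [← integral_indicator_one hm]
  have hε : ∀ n : ℕ, 0 < u / ((n : ℝ) + 2) := fun n => by positivity
  have key : ∀ n : ℕ, (∫ x, max (u - |x| ^ α) 0 ∂ν
        - ∫ x, max (u - u / (n + 2) - |x| ^ α) 0 ∂ν) / (u / (n + 2))
      = ∫ x, (max (u - |x| ^ α) 0 - max (u - u / (n + 2) - |x| ^ α) 0) / (u / (n + 2)) ∂ν := by
    intro n
    rw [integral_div, integral_sub (wi_integrable α hα ν _) (wi_integrable α hα ν _)]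
  simp_rw [key]
  refine tendsto_integral_of_dominated_convergence (fun _ => (1 : ℝ)) ?_ (integrable_const _) ?_ ?_
  · intro n
    exact Continuous.aestronglyMeasurable (by fun_prop)
  · intro n
    refine Filter.Eventually.of_forall fun x => ?_
    have := hε n
    rw [Real.norm_eq_abs, abs_div, abs_of_pos this, div_le_one this, abs_le]
    constructor
    · rcases max_cases (u - |x| ^ α) 0 with h | h <;>
      rcases max_cases (u - u / (n + 2) - |x| ^ α) 0 with h' | h' <;> linarith
    · rcases max_cases (u - |x| ^ α) 0 with h | h <;>
      rcases max_cases (u - u / (n + 2) - |x| ^ α) 0 with h' | h' <;> linarith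
  · refine Filter.Eventually.of_forall fun x => ?_
    by_cases hx : |x| ^ α < u
    · have h0 : Filter.Tendsto (fun n : ℕ => u / ((n : ℝ) + 2)) Filter.atTop (nhds 0) :=
        tendsto_const_nhds.div_atTop
          (Filter.tendsto_atTop_add_const_right _ _ tendsto_natCast_atTop_atTop)
      have hev := h0.eventually (gt_mem_nhds (sub_pos.2 hx))
      rw [Set.indicator_of_mem (show x ∈ {x : ℝ | |x| ^ α < u} from hx)]
      refine tendsto_const_nhds.congr' ?_
      filter_upwards [hev] with n hn
      have := hε n
      rw [max_eq_left (by linarith), max_eq_left (by linarith), Pi.one_apply,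
        eq_div_iff this.ne']
      ring
    · rw [Set.indicator_of_notMem (show x ∉ {x : ℝ | |x| ^ α < u} from hx)]
      refine tendsto_const_nhds.congr fun n => ?_
      have := hε n
      push Not at hx
      rw [max_eq_right (by linarith), max_eq_right (by linarith)]
      simp

lemma wi_symm (ν : Measure ℝ) (h : IsSymmetric ν) (A : Set ℝ) (hA : MeasurableSet A) :
    ν A + ν A = ∫⁻ y, (A.indicator 1 y + A.indicator 1 (-y)) ∂(ν.map (fun x => |x|)) := by
  have hi : Measurable (A.indicator (1 : ℝ → ENNReal)) := measurable_one.indicator hA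
  have hn : Measurable (fun y : ℝ => A.indicator (1 : ℝ → ENNReal) (-y)) := hi.comp measurable_neg
  have hs : Measurable (fun y : ℝ => A.indicator (1 : ℝ → ENNReal) y + A.indicator 1 (-y)) :=
    hi.add hn
  have ha : Measurable (fun x : ℝ => |x|) := continuous_abs.measurable
  rw [lintegral_map hs ha]
  have e : ∀ x : ℝ, A.indicator (1 : ℝ → ENNReal) |x| + A.indicator 1 (-|x|)
      = A.indicator 1 x + A.indicator 1 (-x) := by
    intro x
    rcases abs_cases x with h | h
    · rw [h.1]
    · rw [h.1, neg_neg, add_comm]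
  simp_rw [e]
  rw [lintegral_add_left hi, ← lintegral_map (f := A.indicator (1 : ℝ → ENNReal)) hi measurable_neg]
  have h' : ν.map Neg.neg = ν := h
  first
    | rw [h', lintegral_indicator_one hA]
    | (have h'' : ν.map (fun x => -x) = ν := h
       rw [h'', lintegral_indicator_one hA])

/-- The Williamson transform is injective on symmetric probability measures on `ℝ`. -/
theorem williamson_injective (α : ℝ) (hα : 0 < α)
    (ν₁ ν₂ : Measure ℝ) [IsProbabilityMeasure ν₁] [IsProbabilityMeasure ν₂]
    (h₁ : IsSymmetric ν₁) (h₂ : IsSymmetric ν₂)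
    (h : ∀ t : ℝ, 0 < t →
      ∫ x, max (1 - |x * t| ^ α) 0 ∂ν₁ = ∫ x, max (1 - |x * t| ^ α) 0 ∂ν₂) :
    ν₁ = ν₂ := by
  have hI : ∀ u : ℝ, 0 < u →
      ∫ x, max (u - |x| ^ α) 0 ∂ν₁ = ∫ x, max (u - |x| ^ α) 0 ∂ν₂ := by
    intro u hu
    rw [wi_trunc α hα _ u hu, wi_trunc α hα _ u hu, h _ (Real.rpow_pos_of_pos hu _)]
  have hS : ∀ u : ℝ, 0 < u → ν₁ {x | |x| ^ α < u} = ν₂ {x | |x| ^ α < u} := by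
    intro u hu
    have t1 := wi_tendsto α hα ν₁ u hu
    have t2 := wi_tendsto α hα ν₂ u hu
    have : ∀ n : ℕ, 0 < u - u / ((n : ℝ) + 2) := by
      intro n
      rw [sub_pos]
      exact div_lt_self hu (by linarith [(Nat.cast_nonneg n : (0 : ℝ) ≤ n)])
    simp_rw [hI u hu, fun n => hI _ (this n)] at t1
    have := tendsto_nhds_unique t1 t2
    exact (measureReal_eq_measureReal_iff).1 this
  have hmap : ν₁.map (fun x => |x|) = ν₂.map (fun x => |x|) := by
    have hma : Measurable (fun x : ℝ => |x|) := continuous_abs.measurable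
    haveI := Measure.isProbabilityMeasure_map (μ := ν₁) hma.aemeasurable
    haveI := Measure.isProbabilityMeasure_map (μ := ν₂) hma.aemeasurable
    refine Measure.ext_of_Ici _ _ fun a => ?_
    have hio : (ν₁.map (fun x => |x|)) (Set.Iio a) = (ν₂.map (fun x => |x|)) (Set.Iio a) := by
      rw [Measure.map_apply hma measurableSet_Iio, Measure.map_apply hma measurableSet_Iio]
      rcases le_or_gt a 0 with ha | ha
      · have : (fun x : ℝ => |x|) ⁻¹' Set.Iio a = ∅ := by
          ext x
          simpa using ha.trans (abs_nonneg x)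
        simp [this]
      · have : (fun x : ℝ => |x|) ⁻¹' Set.Iio a = {x | |x| ^ α < a ^ α} := by
          ext x
          exact (Real.rpow_lt_rpow_iff (abs_nonneg x) ha.le hα).symm
        rw [this]
        exact hS _ (Real.rpow_pos_of_pos ha _)
    rw [← Set.compl_Iio, prob_compl_eq_one_sub measurableSet_Iio,
      prob_compl_eq_one_sub measurableSet_Iio, hio]
  ext A hA
  have e := wi_symm ν₁ h₁ A hA
  rw [hmap, ← wi_symm ν₂ h₂ A hA, ← two_mul, ← two_mul] at e
  exact (ENNReal.mul_right_inj two_ne_zero ENNReal.ofNat_ne_top).1 e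
end

section
/- Let α > 0 and set Ψ(t) = (1 − |t|^α)₊. For all x, y, t ∈ ℝ one has ∫_ℝ Ψ(ut) (δ̃_x ▵_α δ̃_y)(du) = Ψ(xt) Ψ(yt). -/
open MeasureTheory

theorem Psi_cont (α : ℝ) (hα : 0 < α) (s : ℝ) : Continuous fun u : ℝ => Psi α (u * s) := by
  unfold Psi
  have h : Continuous fun u : ℝ => |u * s| ^ α :=
    Continuous.rpow_const (by fun_prop) (fun _ => Or.inr hα.le)
  fun_prop

theorem Psi_abs (α s : ℝ) : Psi α |s| = Psi α s := by simp [Psi]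

theorem Psi_nonneg (α s : ℝ) : 0 ≤ Psi α s := le_max_right _ _

theorem Psi_le_one (α s : ℝ) : Psi α s ≤ 1 := by
  unfold Psi
  have : 0 ≤ |s| ^ α := by positivity
  exact max_le (by linarith) zero_le_one

theorem hasDerivAt_posPart_sq (v : ℝ) :
    HasDerivAt (fun v : ℝ => (max v 0) ^ 2) (2 * max v 0) v := by
  rcases lt_trichotomy v 0 with h | h | h
  · rw [max_eq_right h.le, mul_zero]
    refine (hasDerivAt_const v (0:ℝ)).congr_of_eventuallyEq ?_
    filter_upwards [Iio_mem_nhds h] with w hw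
    rw [max_eq_right (le_of_lt hw)]; norm_num
  · subst h
    rw [hasDerivAt_iff_isLittleO]
    have h1 : (fun w : ℝ => w ^ 2) =o[nhds 0] fun w : ℝ => w := by
      have := (hasDerivAt_pow 2 (0:ℝ)).isLittleO
      simpa using this
    have h2 : (fun w : ℝ => max w 0 ^ 2) =O[nhds 0] fun w : ℝ => w ^ 2 := by
      refine Asymptotics.IsBigO.of_bound 1 (Filter.Eventually.of_forall fun w => ?_)
      rcases le_total w 0 with h | h
      · rw [max_eq_right h]; simp; positivity
      · rw [max_eq_left h]; simp
    simpa using h2.trans_isLittleO h1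
  · rw [max_eq_left h.le]
    have := hasDerivAt_pow 2 v
    refine (this.congr_of_eventuallyEq ?_).congr_deriv (by simp)
    filter_upwards [Ioi_mem_nhds h] with w hw
    rw [max_eq_left (le_of_lt hw)]

theorem core_integral (α : ℝ) (hα : 0 < α) (s : ℝ) (hs : 0 ≤ s) :
    ∫ u in Set.Ioi (1:ℝ), α * u ^ (-2 * α - 1) * Psi α (u * s) = Psi α s ^ 2 / 2 := by
  have key := integral_Ioi_of_hasDerivAt_of_nonneg' (a := (1:ℝ)) (l := 0)
    (g := fun u : ℝ => -(1/2) * (max (u ^ (-α) - s ^ α) 0) ^ 2)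
    (g' := fun u : ℝ => α * u ^ (-2 * α - 1) * Psi α (u * s)) ?_ ?_ ?_
  · rw [key]
    simp only [Real.one_rpow, Psi, abs_of_nonneg hs]
    ring
  · intro u hu
    have hu0 : 0 < u := lt_of_lt_of_le one_pos hu
    have h1 : HasDerivAt (fun u : ℝ => u ^ (-α) - s ^ α) (-α * u ^ (-α - 1)) u :=
      (Real.hasDerivAt_rpow_const (Or.inl hu0.ne')).sub_const _
    have h2 := ((hasDerivAt_posPart_sq (u ^ (-α) - s ^ α)).comp u h1).const_mul (-(1/2 : ℝ))
    refine h2.congr_deriv ?_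
    have e1 : u ^ (-2 * α - 1) = u ^ (-α - 1) * u ^ (-α) := by
      rw [← Real.rpow_add hu0]; congr 1; ring
    have e2 : max (u ^ (-α) - s ^ α) 0 = u ^ (-α) * Psi α (u * s) := by
      unfold Psi
      rw [mul_max_of_nonneg _ _ (by positivity), mul_zero, abs_of_nonneg (by positivity),
        Real.mul_rpow hu0.le hs, mul_sub, ← mul_assoc, ← Real.rpow_add hu0]
      simp
    rw [e1, e2]; ring
  · intro u hu
    have hu0 : 0 < u := lt_trans one_pos hu
    have := Psi_nonneg α (u * s)
    positivity
  · have h1 : Filter.Tendsto (fun u : ℝ => u ^ (-α)) Filter.atTop (nhds 0) :=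
      tendsto_rpow_neg_atTop hα
    have h2 := (((h1.sub_const (s ^ α)).max (tendsto_const_nhds (x := (0:ℝ)))).pow 2).const_mul
      (-(1/2 : ℝ))
    have h3 : max (0 - s ^ α) 0 = 0 := max_eq_right (by have : 0 ≤ s ^ α := by positivity
                                                        linarith)
    rw [h3] at h2
    simpa using h2

theorem pareto_meas (α : ℝ) : Measurable fun y : ℝ =>
    ENNReal.ofReal (if 1 ≤ |y| then α * |y| ^ (-2 * α - 1) else 0) := by
  refine ENNReal.measurable_ofReal.comp (Measurable.ite ?_ ?_ measurable_const)
  · exact measurableSet_le measurable_const measurable_norm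
  · exact (measurable_norm.pow_const _).const_mul α

theorem pareto_integral (α : ℝ) (hα : 0 < α) (s : ℝ) :
    ∫ u, Psi α (u * s) ∂(pareto α) = Psi α s ^ 2 := by
  unfold pareto
  rw [integral_withDensity_eq_integral_toReal_smul (pareto_meas α) (by simp)]
  have e : ∀ u : ℝ, (ENNReal.ofReal (if 1 ≤ |u| then α * |u| ^ (-2 * α - 1) else 0)).toReal •
      Psi α (u * s) = (fun v : ℝ => Set.indicator (Set.Ici (1:ℝ))
        (fun v => α * v ^ (-2 * α - 1) * Psi α (v * |s|)) v) |u| := by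
    intro u
    by_cases h : 1 ≤ |u|
    · have : 0 ≤ α * |u| ^ (-2 * α - 1) := by positivity
      simp only [h, if_true, smul_eq_mul, ENNReal.toReal_ofReal this, Set.indicator,
        Set.mem_Ici]
      rw [← abs_mul, Psi_abs]
    · simp [h]
  simp_rw [e]
  rw [integral_comp_abs, setIntegral_indicator measurableSet_Ici]
  have : Set.Ioi (0:ℝ) ∩ Set.Ici 1 = Set.Ici 1 :=
    Set.inter_eq_right.mpr (Set.Ici_subset_Ioi.mpr one_pos)
  rw [this, integral_Ici_eq_integral_Ioi, core_integral α hα _ (abs_nonneg s), Psi_abs]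
  ring

theorem pareto_integrable (α : ℝ) (hα : 0 < α) (s : ℝ) :
    Integrable (fun u => Psi α (u * s)) (pareto α) := by
  have h0 : Integrable (fun u => Psi α (u * 0)) (pareto α) := by
    by_contra h
    have h1 := pareto_integral α hα 0
    rw [integral_undef h] at h1
    simp [Psi, Real.zero_rpow hα.ne'] at h1
  refine h0.mono (Psi_cont α hα s).aestronglyMeasurable (Filter.Eventually.of_forall fun u => ?_)
  rw [Real.norm_of_nonneg (Psi_nonneg _ _), Real.norm_of_nonneg (Psi_nonneg _ _)]
  refine (Psi_le_one _ _).trans ?_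
  simp [Psi, Real.zero_rpow hα.ne']

theorem delta_integrable (α s : ℝ) :
    Integrable (fun u => Psi α (u * s)) (deltaTilde 1) := by
  unfold deltaTilde
  refine Integrable.smul_measure ?_ (by simp)
  exact (integrable_dirac (by simp)).add_measure (integrable_dirac (by simp))

theorem delta_integral (α s : ℝ) :
    ∫ u, Psi α (u * s) ∂(deltaTilde 1) = Psi α s := by
  unfold deltaTilde
  rw [integral_smul_measure,
    integral_add_measure (integrable_dirac (by simp)) (integrable_dirac (by simp))]
  simp only [integral_dirac]
  rw [← Psi_abs α (-1 * s)]
  simp [Psi_abs]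
  ring

theorem mix_integral (α : ℝ) (hα : 0 < α) (M m t : ℝ) (hm : 0 ≤ m) (hmM : m ≤ M) :
    ∫ u, Psi α (u * t) ∂(rescale M
      (ENNReal.ofReal ((if M = 0 then 0 else m / M) ^ α) • pareto α +
        ENNReal.ofReal (1 - (if M = 0 then 0 else m / M) ^ α) • deltaTilde 1))
      = Psi α (M * t) * Psi α (m * t) := by
  unfold rescale
  by_cases hM : M = 0
  · have : m = 0 := by linarith
    subst hM this
    simp [Psi, Real.zero_rpow hα.ne']
  have hM0 : 0 < M := lt_of_le_of_ne (hm.trans hmM) (Ne.symm hM)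
  simp only [hM, if_false]
  rw [integral_map (by fun_prop) (Psi_cont α hα t).aestronglyMeasurable]
  have e : ∀ u : ℝ, Psi α (M * u * t) = Psi α (u * (M * t)) := fun u => by congr 1; ring
  simp_rw [e]
  have hr0 : 0 ≤ (m / M) ^ α := by positivity
  have hr1 : (m / M) ^ α ≤ 1 := Real.rpow_le_one (by positivity) ((div_le_one hM0).2 hmM) hα.le
  rw [integral_add_measure ((pareto_integrable α hα _).smul_measure (by simp))
    ((delta_integrable α _).smul_measure (by simp)), integral_smul_measure, integral_smul_measure,
    pareto_integral α hα, delta_integral, ENNReal.toReal_ofReal hr0,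
    ENNReal.toReal_ofReal (by linarith)]
  have hmt : |m * t| ^ α = (m / M) ^ α * |M * t| ^ α := by
    rw [← Real.mul_rpow (by positivity) (by positivity)]
    congr 1
    rw [abs_mul, abs_mul, abs_of_nonneg hm, abs_of_pos hM0]
    field_simp
  have hMt : 0 ≤ |M * t| ^ α := by positivity
  unfold Psi
  rw [hmt]
  rcases le_total (1 - |M * t| ^ α) 0 with h | h
  · rw [max_eq_right h]; simp
  · have : 0 ≤ 1 - (m / M) ^ α * |M * t| ^ α := by nlinarith
    rw [max_eq_left h, max_eq_left this]
    simp only [smul_eq_mul]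
    ring

/-- `∫ Ψ(ut) (δ̃_x ▵_α δ̃_y)(du) = Ψ(xt) Ψ(yt)` for all `x, y, t ∈ ℝ`. -/
theorem williamson_kendallPoint (α : ℝ) (hα : 0 < α) (x y t : ℝ) :
    ∫ u, Psi α (u * t) ∂(kendallPoint α x y) = Psi α (x * t) * Psi α (y * t) := by
  have h := mix_integral α hα (max |x| |y|) (min |x| |y|) t (le_min (abs_nonneg x) (abs_nonneg y))
    min_le_max
  have ha : ∀ z : ℝ, Psi α (|z| * t) = Psi α (z * t) := fun z => by
    rw [← Psi_abs α (|z| * t), ← Psi_abs α (z * t), abs_mul, abs_abs, abs_mul]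
  unfold kendallPoint
  refine h.trans ?_
  rcases le_total |x| |y| with hxy | hxy
  · rw [max_eq_right hxy, min_eq_left hxy, ha, ha, mul_comm]
  · rw [max_eq_left hxy, min_eq_right hxy, ha, ha]
end

section
/- Let α > 0. The Kendall convolution ▵_α is associative on symmetric probability measures: for all symmetric probability measures ν₁, ν₂, ν₃ on ℝ, (ν₁ ▵_α ν₂) ▵_α ν₃ = ν₁ ▵_α (ν₂ ▵_α ν₃). -/
open MeasureTheory

open Set

lemma ka_lint_abs (h : ℝ → ENNReal) :
    ∫⁻ v, h |v| = 2 * ∫⁻ v in Ioi (0:ℝ), h v := by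
  have e1 : ∫⁻ v in Ioi (0:ℝ), h |v| = ∫⁻ v in Ioi (0:ℝ), h v :=
    setLIntegral_congr_fun measurableSet_Ioi (fun x hx => by
      simp only [abs_of_pos (show (0:ℝ) < x from hx)])
  have e2 : ∫⁻ v in Iio (0:ℝ), h |v| = ∫⁻ v in Ioi (0:ℝ), h |v| := by
    have := (Measure.measurePreserving_neg (volume : Measure ℝ)).setLIntegral_comp_preimage_emb
      (Homeomorph.neg ℝ).measurableEmbedding (fun v => h |v|) (Ioi (0:ℝ))
    simpa using this
  have e3 : ∫⁻ v in Iic (0:ℝ), h |v| = ∫⁻ v in Iio (0:ℝ), h |v| :=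
    setLIntegral_congr Iio_ae_eq_Iic.symm
  rw [← lintegral_add_compl (fun v => h |v|) (measurableSet_Ioi (a := (0:ℝ))), compl_Ioi,
    e3, e2, e1, two_mul]

/-- density -/
noncomputable def kaDens (α y : ℝ) : ENNReal :=
  ENNReal.ofReal (if 1 ≤ |y| then α * |y| ^ (-2 * α - 1) else 0)

lemma kaDens_meas (α : ℝ) : Measurable (kaDens α) := by
  unfold kaDens
  refine ENNReal.measurable_ofReal.comp (Measurable.ite ?_ (by fun_prop) (by fun_prop))
  exact measurableSet_le measurable_const (by fun_prop)

lemma ka_pareto_lint (α : ℝ) {g : ℝ → ENNReal} (hg : Measurable g) :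
    ∫⁻ v, g v ∂(pareto α) = ∫⁻ v, kaDens α v * g v := by
  have := lintegral_withDensity_eq_lintegral_mul volume (kaDens_meas α) hg
  exact this

lemma ka_pareto_neg (α : ℝ) {g : ℝ → ENNReal} (hg : Measurable g) :
    ∫⁻ v, g (-v) ∂(pareto α) = ∫⁻ v, g v ∂(pareto α) := by
  rw [ka_pareto_lint α hg, ka_pareto_lint α (g := fun v => g (-v)) (hg.comp measurable_neg)]
  rw [← lintegral_neg_eq_self (μ := volume) (fun v => kaDens α v * g v)]
  simp [kaDens]

lemma ka_pareto_abs (α : ℝ) {g : ℝ → ENNReal} (hg : Measurable g) :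
    ∫⁻ v, g |v| ∂(pareto α) = 2 * ∫⁻ v in Ici (1:ℝ), ENNReal.ofReal (α * v ^ (-2 * α - 1)) * g v := by
  rw [ka_pareto_lint α (g := fun v => g |v|) (hg.comp measurable_abs)]
  have : ∀ v, kaDens α v * g |v| = (fun w => kaDens α w * g w) |v| := by
    intro v; simp [kaDens]
  simp_rw [this]
  rw [ka_lint_abs (fun w => kaDens α w * g w)]
  congr 1
  rw [← lintegral_indicator measurableSet_Ioi, ← lintegral_indicator measurableSet_Ici]
  congr 1; ext v
  by_cases h0 : 0 < v
  · by_cases h1 : 1 ≤ v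
    · simp [indicator, h0, h1, kaDens, abs_of_pos h0]
    · simp [indicator, h0, h1, kaDens, abs_of_pos h0]
  · have : ¬ 1 ≤ v := by linarith
    simp [indicator, h0, this]

lemma ka_pareto_prob (α : ℝ) (hα : 0 < α) : IsProbabilityMeasure (pareto α) := by
  constructor
  have := ka_pareto_abs α (g := fun _ => 1) measurable_const
  simp only [lintegral_one, mul_one] at this
  rw [this, setLIntegral_congr Ioi_ae_eq_Ici.symm, ← ofReal_integral_eq_lintegral_ofReal,
    integral_const_mul, integral_Ioi_rpow_of_lt (by linarith) one_pos]
  · rw [Real.one_rpow, show -2 * α -1 + 1 = -(2*α) by ring, neg_div_neg_eq,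
      show (2:ENNReal) = ENNReal.ofReal 2 by simp, ← ENNReal.ofReal_mul (by norm_num)]
    rw [show 2 * (α * (1 / (2*α))) = 1 by field_simp]; simp
  · exact (integrableOn_Ioi_rpow_of_lt (by linarith) one_pos).const_mul _
  · refine (ae_restrict_iff' measurableSet_Ioi).2 (Filter.Eventually.of_forall fun v hv => ?_)
    have : (0:ℝ) < v := lt_trans one_pos hv
    simp only [Pi.zero_apply]; positivity

lemma ka_pareto_calc (α : ℝ) (hα : 0 < α) (s d : ℝ) (hs : 1 < s) (hd : 0 ≤ d) (hds : d * s ^ α ≤ 1) :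
    ∫⁻ v, (if |v| < s then ENNReal.ofReal (1 - d * |v| ^ α) else 0) ∂(pareto α)
      = ENNReal.ofReal (1 - s ^ (-2 * α) - 2 * d * (1 - s ^ (-α))) := by
  have hm : Measurable (fun v : ℝ => if v < s then ENNReal.ofReal (1 - d * v ^ α) else 0) := by
    refine Measurable.ite measurableSet_Iio (by fun_prop) (by fun_prop)
  rw [ka_pareto_abs α hm]
  have e : ∫⁻ v in Ici (1:ℝ), ENNReal.ofReal (α * v ^ (-2 * α - 1)) *
      (if v < s then ENNReal.ofReal (1 - d * v ^ α) else 0)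
      = ∫⁻ v in Ioc (1:ℝ) s, ENNReal.ofReal (α * v ^ (-2 * α - 1) * (1 - d * v ^ α)) := by
    rw [setLIntegral_congr (Ioo_ae_eq_Ioc (a := (1:ℝ)) (b := s)).symm,
      setLIntegral_congr (Ioo_ae_eq_Ico (a := (1:ℝ)) (b := s))]
    rw [← lintegral_indicator measurableSet_Ico, ← lintegral_indicator measurableSet_Ici]
    congr 1; ext v
    by_cases h1 : 1 ≤ v
    · by_cases h2 : v < s
      · have : 0 < v := by linarith
        simp only [indicator, mem_Ici, h1, h2, mem_Ico, and_self, if_true]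
        rw [← ENNReal.ofReal_mul (by positivity)]
      · simp [indicator, h1, h2]
    · simp [indicator, h1]
  have hpos : ∀ v ∈ Set.uIcc 1 s, 0 < v := by
    intro v hv; rw [uIcc_of_le hs.le] at hv; linarith [hv.1]
  have hcont : ContinuousOn (fun v : ℝ => α * v ^ (-2 * α - 1) * (1 - d * v ^ α)) (uIcc 1 s) := by
    have h : ∀ p : ℝ, ContinuousOn (fun v : ℝ => v ^ p) (uIcc 1 s) := fun p =>
      continuousOn_id.rpow_const (fun v hv => Or.inl (hpos v hv).ne')
    exact (continuousOn_const.mul (h _)).mul (continuousOn_const.sub (continuousOn_const.mul (h _)))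
  rw [e, ← ofReal_integral_eq_lintegral_ofReal, ← intervalIntegral.integral_of_le hs.le,
    intervalIntegral.integral_eq_sub_of_hasDerivAt
      (f := fun v => -(v ^ (-2 * α)) / 2 + d * v ^ (-α)) _ hcont.intervalIntegrable]
  · rw [show (2:ENNReal) = ENNReal.ofReal 2 by simp, ← ENNReal.ofReal_mul (by norm_num)]
    congr 1; simp only [Real.one_rpow]; ring
  · intro v hv
    have h0 := hpos v hv
    have h1 := (Real.hasDerivAt_rpow_const (x := v) (p := -2 * α) (Or.inl h0.ne'))
    have h2 := (Real.hasDerivAt_rpow_const (x := v) (p := -α) (Or.inl h0.ne'))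
    refine ((h1.neg.div_const 2).add (h2.const_mul d)).congr_deriv ?_
    have : v ^ (-α - 1) = v ^ (-2 * α - 1) * v ^ α := by
      rw [← Real.rpow_add h0]; congr 1; ring
    rw [this]; ring
  · have := hcont.intervalIntegrable (μ := volume)
    rwa [intervalIntegrable_iff_integrableOn_Ioc_of_le hs.le] at this
  · refine (ae_restrict_iff' measurableSet_Ioc).2 (Filter.Eventually.of_forall fun v hv => ?_)
    have h0 : (0:ℝ) < v := lt_trans one_pos hv.1
    have : d * v ^ α ≤ d * s ^ α := by
      gcongr; exact hv.2
    have : 0 ≤ 1 - d * v ^ α := by linarith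
    simp only [Pi.zero_apply]; positivity

lemma ka_kp_lint (α : ℝ) (hα : 0 < α) (x y : ℝ) {g : ℝ → ENNReal} (hg : Measurable g) :
    ∫⁻ u, g u ∂(kendallPoint α x y) =
      ENNReal.ofReal ((min |x| |y| / max |x| |y|) ^ α) * ∫⁻ v, g (max |x| |y| * v) ∂(pareto α) +
      ENNReal.ofReal (1 - (min |x| |y| / max |x| |y|) ^ α) *
        (2⁻¹ * (g (max |x| |y|) + g (-max |x| |y|))) := by
  unfold kendallPoint rescale
  by_cases hM : max |x| |y| = 0
  · simp only [hM, if_true, div_zero, neg_zero, Real.zero_rpow hα.ne']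
    rw [lintegral_dirac' _ hg]
    simp only [ENNReal.ofReal_zero, zero_mul, zero_add, sub_zero, ENNReal.ofReal_one, one_mul,
      ← two_mul]
    rw [← mul_assoc, ENNReal.inv_mul_cancel (by simp) (by simp), one_mul]
  · simp only [hM, if_false]
    rw [lintegral_map hg (by fun_prop), lintegral_add_measure, lintegral_smul_measure,
      lintegral_smul_measure, deltaTilde, lintegral_smul_measure, lintegral_add_measure,
      lintegral_dirac' _ (by fun_prop), lintegral_dirac' _ (by fun_prop)]
    simp

lemma ka_kp_comm (α x y : ℝ) : kendallPoint α x y = kendallPoint α y x := by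
  unfold kendallPoint
  rw [max_comm, min_comm]

lemma ka_rho (α : ℝ) (hα : 0 < α) (x y : ℝ) :
    0 ≤ (min |x| |y| / max |x| |y|) ^ α ∧ (min |x| |y| / max |x| |y|) ^ α ≤ 1 := by
  have h0 : 0 ≤ min |x| |y| / max |x| |y| :=
    div_nonneg (le_min (abs_nonneg _) (abs_nonneg _)) (le_max_of_le_left (abs_nonneg _))
  refine ⟨Real.rpow_nonneg h0 _, Real.rpow_le_one h0 ?_ hα.le⟩
  exact div_le_one_of_le₀ min_le_max (le_max_of_le_left (abs_nonneg _))

lemma ka_kp_prob (α : ℝ) (hα : 0 < α) (x y : ℝ) : IsProbabilityMeasure (kendallPoint α x y) := by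
  constructor
  have := ka_kp_lint α hα x y (g := fun _ => 1) measurable_const
  have hp := ka_pareto_prob α hα
  obtain ⟨h0, h1⟩ := ka_rho α hα x y
  rw [lintegral_one] at this
  rw [this, lintegral_one, measure_univ, one_add_one_eq_two,
    ENNReal.inv_mul_cancel (by simp) (by simp), mul_one, mul_one,
    ← ENNReal.ofReal_add h0 (by linarith)]
  simp

lemma ka_kp_neg (α : ℝ) (hα : 0 < α) (x y : ℝ) {g : ℝ → ENNReal} (hg : Measurable g) :
    ∫⁻ u, g (-u) ∂(kendallPoint α x y) = ∫⁻ u, g u ∂(kendallPoint α x y) := by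
  rw [ka_kp_lint α hα x y hg, ka_kp_lint α hα x y (g := fun u => g (-u)) (by fun_prop)]
  have := ka_pareto_neg α (g := fun v => g (max |x| |y| * v)) (by fun_prop)
  rw [← this]
  simp only [mul_neg, neg_neg]
  rw [add_comm (g (-max |x| |y|))]

lemma ka_kp_meas (α : ℝ) (hα : 0 < α) :
    Measurable (fun p : ℝ × ℝ => kendallPoint α p.1 p.2) := by
  refine Measure.measurable_of_measurable_coe _ fun s hs => ?_
  have hi : Measurable (s.indicator (1 : ℝ → ENNReal)) := measurable_one.indicator hs
  have hp := ka_pareto_prob α hα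
  have : ∀ p : ℝ × ℝ, kendallPoint α p.1 p.2 s = _ := fun p => by
    rw [← lintegral_indicator_one hs, ka_kp_lint α hα p.1 p.2 hi]
  simp_rw [this]
  have h1 : Measurable (fun p : ℝ × ℝ =>
      ∫⁻ v, s.indicator (1 : ℝ → ENNReal) (max |p.1| |p.2| * v) ∂(pareto α)) := by
    refine Measurable.lintegral_prod_right'
      (f := fun q : (ℝ × ℝ) × ℝ => s.indicator (1 : ℝ → ENNReal) (max |q.1.1| |q.1.2| * q.2)) ?_
    exact hi.comp (by fun_prop)
  have h2 : Measurable (fun p : ℝ × ℝ => s.indicator (1 : ℝ → ENNReal) (max |p.1| |p.2|)) :=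
    hi.comp (by fun_prop)
  have h3 : Measurable (fun p : ℝ × ℝ => s.indicator (1 : ℝ → ENNReal) (-max |p.1| |p.2|)) :=
    hi.comp (by fun_prop)
  fun_prop

/-- kernel formula -/
lemma ka_kp_calc (α : ℝ) (hα : 0 < α) (x y t c : ℝ) (ht : 0 < t) (hc : 0 ≤ c) (hc1 : c ≤ 1) :
    ∫⁻ u, (if |u| < t then ENNReal.ofReal (1 - c * (|u| / t) ^ α) else 0) ∂(kendallPoint α x y)
     = if |x| < t ∧ |y| < t then ENNReal.ofReal (1 - (|x| / t) ^ α * (|y| / t) ^ α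
        - c * ((|x| / t) ^ α + (|y| / t) ^ α - 2 * (|x| / t) ^ α * (|y| / t) ^ α)) else 0 := by
  wlog hxy : |x| ≤ |y| generalizing x y
  · rw [ka_kp_comm, this y x (le_of_not_ge hxy)]
    simp only [and_comm (a := |x| < t)]
    congr 2
    ring
  have hm : Measurable (fun u : ℝ =>
      if |u| < t then ENNReal.ofReal (1 - c * (|u| / t) ^ α) else 0) := by
    refine Measurable.ite (measurableSet_lt (by fun_prop) measurable_const) (by fun_prop)
      (by fun_prop)
  obtain ⟨hr0, hr1⟩ := ka_rho α hα x y
  rw [ka_kp_lint α hα x y hm]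
  rw [max_eq_right hxy, min_eq_left hxy] at *
  simp only [abs_neg, abs_abs, abs_mul]
  have hhalf : ∀ z : ENNReal, 2⁻¹ * (z + z) = z := fun z => by
    rw [← two_mul, ← mul_assoc, ENNReal.inv_mul_cancel (by simp) (by simp), one_mul]
  rw [hhalf]
  by_cases hyt : |y| < t
  · rw [if_pos hyt, if_pos ⟨hxy.trans_lt hyt, hyt⟩]
    rcases (abs_nonneg y).eq_or_lt with hy0 | hy0
    · have hx0 : |x| = 0 := le_antisymm (hy0 ▸ hxy) (abs_nonneg x)
      simp [← hy0, hx0, Real.zero_rpow hα.ne']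
    · set b := (|y| / t) ^ α with hb
      have hb0 : 0 < b := by positivity
      have hb1 : b ≤ 1 := Real.rpow_le_one (by positivity) ((div_le_one ht).2 hyt.le) hα.le
      set r := (|x| / |y|) ^ α with hr
      have hxr : (|x| / t) ^ α = r * b := by
        rw [hr, hb, ← Real.mul_rpow (by positivity) (by positivity)]
        congr 1; field_simp
      have hsb : (t / |y|) ^ α = b⁻¹ := by
        rw [hb, ← Real.inv_rpow (by positivity), inv_div]
      have hs1 : (t / |y|) ^ (-α) = b := by
        rw [Real.rpow_neg (by positivity), hsb, inv_inv]
      have hs2 : (t / |y|) ^ (-2 * α) = b ^ 2 := by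
        rw [show -2 * α = -α * 2 by ring, Real.rpow_mul (by positivity), hs1]; simp
      have hP := ka_pareto_calc α hα (t / |y|) (c * b) ((one_lt_div hy0).2 hyt) (by positivity)
        (by rw [hsb, mul_assoc, mul_inv_cancel₀ hb0.ne', mul_one]; exact hc1)
      have : ∀ v : ℝ, (if |y| * |v| < t then ENNReal.ofReal (1 - c * (|y| * |v| / t) ^ α) else 0)
          = if |v| < t / |y| then ENNReal.ofReal (1 - c * b * |v| ^ α) else 0 := by
        intro v
        have e1 : |y| * |v| < t ↔ |v| < t / |y| := by rw [lt_div_iff₀ hy0, mul_comm]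
        have e2 : (|y| * |v| / t) ^ α = b * |v| ^ α := by
          rw [hb, ← Real.mul_rpow (by positivity) (by positivity)]; congr 1; ring
        simp only [e1, e2, mul_assoc]
      simp_rw [this]
      have hcb : c * b ≤ 1 := mul_le_one₀ hc1 hb0.le hb1
      have hcb2 : c * b ≤ b := mul_le_of_le_one_left hb0.le hc1
      have hnn : 0 ≤ 1 - b ^ 2 - 2 * (c * b) * (1 - b) := by
        nlinarith [mul_nonneg (sub_nonneg.2 hcb2) (sub_nonneg.2 hb1), sq_nonneg (1 - b)]
      rw [hP, hs1, hs2, hxr, ← ENNReal.ofReal_mul hr0, ← ENNReal.ofReal_mul (by linarith),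
        ← ENNReal.ofReal_add (mul_nonneg hr0 hnn) (mul_nonneg (by linarith) (by linarith))]
      congr 1; ring
  · rw [if_neg hyt, if_neg (fun h => hyt h.2)]
    have hy : t ≤ |y| := not_lt.1 hyt
    have hy0 : 0 < |y| := ht.trans_le hy
    have h2 : Measurable (fun v : ℝ =>
      if |y| * |v| < t then ENNReal.ofReal (1 - c * (|y| * |v| / t) ^ α) else 0) := by
      refine Measurable.ite (measurableSet_lt (by fun_prop) measurable_const) (by fun_prop)
        (by fun_prop)
    rw [ka_pareto_lint α h2]
    have : ∀ v : ℝ, kaDens α v *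
        (if |y| * |v| < t then ENNReal.ofReal (1 - c * (|y| * |v| / t) ^ α) else 0) = 0 := by
      intro v
      by_cases hv : 1 ≤ |v|
      · rw [if_neg, mul_zero]
        nlinarith
      · simp [kaDens, hv]
    simp [this]

lemma ka_kp_ball (α : ℝ) (hα : 0 < α) (x y t : ℝ) (ht : 0 < t) :
    kendallPoint α x y {u | |u| < t}
     = if |x| < t ∧ |y| < t then ENNReal.ofReal (1 - (|x| / t) ^ α * (|y| / t) ^ α) else 0 := by
  have := ka_kp_calc α hα x y t 0 ht le_rfl zero_le_one
  simp only [zero_mul, sub_zero, ENNReal.ofReal_one] at this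
  rw [← this, ← lintegral_indicator_one (measurableSet_lt (by fun_prop) measurable_const)]
  rfl

/-- triple convolution of point masses -/
noncomputable def kaJ (α x y z : ℝ) : Measure ℝ :=
  (kendallPoint α x y).bind fun u => kendallPoint α u z

lemma ka_meas_left (α : ℝ) (hα : 0 < α) (z : ℝ) : Measurable (fun u => kendallPoint α u z) :=
  (ka_kp_meas α hα).comp (f := fun u : ℝ => (u, z)) (by fun_prop)

lemma ka_meas_right (α : ℝ) (hα : 0 < α) (z : ℝ) : Measurable (fun u => kendallPoint α z u) :=
  (ka_kp_meas α hα).comp (f := fun u : ℝ => (z, u)) (by fun_prop)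

lemma kaJ_apply (α : ℝ) (hα : 0 < α) (x y z : ℝ) {s : Set ℝ} (hs : MeasurableSet s) :
    kaJ α x y z s = ∫⁻ u, kendallPoint α u z s ∂(kendallPoint α x y) :=
  Measure.bind_apply hs (ka_meas_left α hα z).aemeasurable

lemma kaJ_prob (α : ℝ) (hα : 0 < α) (x y z : ℝ) : IsProbabilityMeasure (kaJ α x y z) := by
  constructor
  rw [kaJ_apply α hα x y z MeasurableSet.univ]
  have := ka_kp_prob α hα
  simp

lemma kaJ_neg (α : ℝ) (hα : 0 < α) (x y z : ℝ) {g : ℝ → ENNReal} (hg : Measurable g) :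
    ∫⁻ u, g (-u) ∂(kaJ α x y z) = ∫⁻ u, g u ∂(kaJ α x y z) := by
  unfold kaJ
  rw [Measure.lintegral_bind (ka_meas_left α hα z).aemeasurable (by fun_prop),
    Measure.lintegral_bind (ka_meas_left α hα z).aemeasurable (by fun_prop)]
  simp_rw [ka_kp_neg α hα _ z hg]

lemma kaJ_ball (α : ℝ) (hα : 0 < α) (x y z t : ℝ) (ht : 0 < t) :
    kaJ α x y z {u | |u| < t} = if (|x| < t ∧ |y| < t) ∧ |z| < t then
      ENNReal.ofReal (1 - (|x| / t) ^ α * (|y| / t) ^ α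
        - (|z| / t) ^ α * ((|x| / t) ^ α + (|y| / t) ^ α - 2 * (|x| / t) ^ α * (|y| / t) ^ α))
      else 0 := by
  rw [kaJ_apply α hα x y z (measurableSet_lt (by fun_prop) measurable_const)]
  simp_rw [ka_kp_ball α hα _ z t ht]
  by_cases hz : |z| < t
  · have := ka_kp_calc α hα x y t ((|z| / t) ^ α) ht (by positivity)
      (Real.rpow_le_one (by positivity) ((div_le_one ht).2 hz.le) hα.le)
    simp only [hz, and_true]
    rw [← this]
    simp only [mul_comm]
  · simp [hz]

lemma kaJ_rot (α : ℝ) (hα : 0 < α) (x y z : ℝ) : kaJ α x y z = kaJ α y z x := by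
  have p1 := kaJ_prob α hα x y z
  have p2 := kaJ_prob α hα y z x
  have hball : ∀ t, kaJ α x y z {u | |u| < t} = kaJ α y z x {u | |u| < t} := by
    intro t
    rcases le_or_gt t 0 with ht | ht
    · have : {u : ℝ | |u| < t} = ∅ := by
        ext u; simp; exact ht.trans (abs_nonneg u)
      simp [this]
    · rw [kaJ_ball α hα x y z t ht, kaJ_ball α hα y z x t ht]
      have : ((|x| < t ∧ |y| < t) ∧ |z| < t) ↔ ((|y| < t ∧ |z| < t) ∧ |x| < t) := by tauto
      simp only [this]
      congr 2; ring
  have habs : (kaJ α x y z).map abs = (kaJ α y z x).map abs := by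
    have q1 := Measure.isProbabilityMeasure_map (μ := kaJ α x y z) (f := (abs : ℝ → ℝ))
      measurable_abs.aemeasurable
    have q2 := Measure.isProbabilityMeasure_map (μ := kaJ α y z x) (f := (abs : ℝ → ℝ))
      measurable_abs.aemeasurable
    refine Measure.ext_of_Ici _ _ fun t => ?_
    rw [← compl_Iio, prob_compl_eq_one_sub measurableSet_Iio,
      prob_compl_eq_one_sub measurableSet_Iio, Measure.map_apply measurable_abs measurableSet_Iio,
      Measure.map_apply measurable_abs measurableSet_Iio]
    exact congrArg (fun q => 1 - q) (hball t)
  ext s hs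
  have hi : Measurable (s.indicator (1 : ℝ → ENNReal)) := measurable_one.indicator hs
  have hg : Measurable (fun v : ℝ => s.indicator (1 : ℝ → ENNReal) v + s.indicator 1 (-v)) := by
    fun_prop
  have key : ∀ x y z : ℝ, 2 * kaJ α x y z s =
      ∫⁻ v, (s.indicator (1 : ℝ → ENNReal) v + s.indicator 1 (-v)) ∂((kaJ α x y z).map abs) := by
    intro x y z
    rw [lintegral_map hg measurable_abs]
    have : ∀ v : ℝ, s.indicator (1 : ℝ → ENNReal) |v| + s.indicator 1 (-|v|)
        = s.indicator (1 : ℝ → ENNReal) v + s.indicator 1 (-v) := by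
      intro v
      rcases abs_choice v with h | h <;> rw [h]
      rw [neg_neg, add_comm]
    simp_rw [this]
    rw [lintegral_add_left hi, kaJ_neg α hα x y z hi, lintegral_indicator_one hs, two_mul]
  have := key x y z
  rw [habs, ← key y z x] at this
  exact (ENNReal.mul_right_inj (by simp) (by simp)).1 this

lemma ka_bind_meas (α : ℝ) (hα : 0 < α) (ν : Measure ℝ) [SFinite ν] :
    Measurable (fun x => ν.bind fun y => kendallPoint α x y) := by
  refine Measure.measurable_of_measurable_coe _ fun s hs => ?_
  simp_rw [fun x => Measure.bind_apply (m := ν) hs (ka_meas_right α hα x).aemeasurable]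
  exact Measurable.lintegral_prod_right' (f := fun p : ℝ × ℝ => kendallPoint α p.1 p.2 s)
    ((Measure.measurable_coe hs).comp (ka_kp_meas α hα))

lemma ka_kendall_lint (α : ℝ) (hα : 0 < α) (μ ν : Measure ℝ) [SFinite ν] {g : ℝ → ENNReal}
    (hg : Measurable g) :
    ∫⁻ u, g u ∂(kendall α μ ν) = ∫⁻ x, ∫⁻ y, ∫⁻ u, g u ∂(kendallPoint α x y) ∂ν ∂μ := by
  unfold kendall
  rw [Measure.lintegral_bind (ka_bind_meas α hα ν).aemeasurable hg.aemeasurable]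
  simp_rw [fun x => Measure.lintegral_bind (m := ν) (ka_meas_right α hα x).aemeasurable
    hg.aemeasurable]

lemma ka_kendall_prob (α : ℝ) (hα : 0 < α) (μ ν : Measure ℝ) [IsProbabilityMeasure μ]
    [IsProbabilityMeasure ν] : IsProbabilityMeasure (kendall α μ ν) := by
  constructor
  have := ka_kp_prob α hα
  rw [← lintegral_one, ka_kendall_lint α hα μ ν measurable_const]
  simp

lemma ka_kendall_apply (α : ℝ) (hα : 0 < α) (μ ν : Measure ℝ) [SFinite ν] {s : Set ℝ}
    (hs : MeasurableSet s) :
    kendall α μ ν s = ∫⁻ x, ∫⁻ y, kendallPoint α x y s ∂ν ∂μ := by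
  rw [← lintegral_indicator_one hs, ka_kendall_lint α hα μ ν (measurable_one.indicator hs)]
  simp_rw [lintegral_indicator_one hs]

/-- The Kendall convolution is associative on symmetric probability measures. -/
theorem kendall_assoc (α : ℝ) (hα : 0 < α)
    (ν₁ ν₂ ν₃ : Measure ℝ)
    [IsProbabilityMeasure ν₁] [IsProbabilityMeasure ν₂] [IsProbabilityMeasure ν₃]
    (h₁ : IsSymmetric ν₁) (h₂ : IsSymmetric ν₂) (h₃ : IsSymmetric ν₃) :
    kendall α (kendall α ν₁ ν₂) ν₃ = kendall α ν₁ (kendall α ν₂ ν₃) := by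
  have p23 := ka_kendall_prob α hα ν₂ ν₃
  have pk := ka_kp_prob α hα
  ext s hs
  have hm : Measurable (fun p : ℝ × ℝ => kendallPoint α p.1 p.2 s) :=
    (Measure.measurable_coe hs).comp (ka_kp_meas α hα)
  rw [ka_kendall_apply α hα _ _ hs, ka_kendall_apply α hα _ _ hs,
    ka_kendall_lint α hα ν₁ ν₂ hm.lintegral_prod_right']
  refine lintegral_congr fun x => ?_
  rw [ka_kendall_lint α hα ν₂ ν₃ (g := fun v => kendallPoint α x v s) (hm.comp (f := fun v : ℝ => (x, v)) (by fun_prop))]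
  refine lintegral_congr fun y => ?_
  rw [lintegral_lintegral_swap hm.aemeasurable]
  refine lintegral_congr fun z => ?_
  rw [← kaJ_apply α hα x y z hs, kaJ_rot α hα x y z, kaJ_apply α hα y z x hs]
  refine lintegral_congr fun v => ?_
  rw [ka_kp_comm]
end

section
/- Let α > 0. For every a ∈ ℝ and all symmetric probability measures ν₁, ν₂ on ℝ, T_a(ν₁ ▵_α ν₂) = (T_a ν₁) ▵_α (T_a ν₂), i.e. the rescaling operators are homomorphisms for the Kendall convolution. -/
open MeasureTheory

theorem measurable_map_mul (μ : Measure ℝ) [SFinite μ] :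
    Measurable fun M : ℝ => μ.map (fun x => M * x) := by
  refine Measure.measurable_of_measurable_coe _ fun s hs => ?_
  have h : ∀ M : ℝ, μ.map (fun x => M * x) s = μ (Prod.mk M ⁻¹' {p : ℝ × ℝ | p.1 * p.2 ∈ s}) := by
    intro M
    rw [Measure.map_apply (by fun_prop) hs]
    rfl
  simp_rw [h]
  exact measurable_measure_prodMk_left ((measurable_fst.mul measurable_snd) hs)

instance (α : ℝ) : SFinite (pareto α) := by unfold pareto; infer_instance

instance (x : ℝ) : SFinite (deltaTilde x) := by unfold deltaTilde; infer_instance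

theorem rescale_comb (M : ℝ) (hM : M ≠ 0) (c d : ENNReal) (μ ν : Measure ℝ) :
    rescale M (c • μ + d • ν) = c • μ.map (fun x => M * x) + d • ν.map (fun x => M * x) := by
  rw [rescale, if_neg hM, Measure.map_add _ _ (by fun_prop), Measure.map_smul, Measure.map_smul]

noncomputable def rr (x y : ℝ) : ℝ :=
  if max |x| |y| = 0 then 0 else min |x| |y| / max |x| |y|

theorem kendallPoint_eq (α x y : ℝ) : kendallPoint α x y =
    if max |x| |y| = 0 then Measure.dirac 0 else
      ENNReal.ofReal (rr x y ^ α) • (pareto α).map (fun z => max |x| |y| * z) +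
      ENNReal.ofReal (1 - rr x y ^ α) • (deltaTilde 1).map (fun z => max |x| |y| * z) := by
  split_ifs with h
  · simp only [kendallPoint, h, rescale, if_true]
  · rw [← rescale_comb _ h]; rfl

theorem measurable_rr : Measurable fun p : ℝ × ℝ => rr p.1 p.2 := by
  unfold rr
  refine Measurable.ite ?_ (by fun_prop) (by fun_prop)
  exact (measurableSet_singleton (0 : ℝ)).preimage
    (f := fun p : ℝ × ℝ => max |p.1| |p.2|) (by fun_prop)

theorem measurable_kendallPoint (α : ℝ) :
    Measurable fun p : ℝ × ℝ => kendallPoint α p.1 p.2 := by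
  simp_rw [kendallPoint_eq]
  have hM : Measurable fun p : ℝ × ℝ => max |p.1| |p.2| := by fun_prop
  refine Measurable.ite ((measurableSet_singleton (0 : ℝ)).preimage hM) measurable_const ?_
  have hr := measurable_rr
  refine Measure.measurable_of_measurable_coe _ fun s hs => ?_
  simp only [Measure.coe_add, Measure.coe_smul, Pi.add_apply, Pi.smul_apply, smul_eq_mul]
  have h1 := (Measure.measurable_coe hs).comp ((measurable_map_mul (pareto α)).comp hM)
  have h2 := (Measure.measurable_coe hs).comp ((measurable_map_mul (deltaTilde 1)).comp hM)
  refine Measurable.add (Measurable.mul (by fun_prop) h1) (Measurable.mul (by fun_prop) h2)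

theorem measurable_bind_kendallPoint (α : ℝ) (ν : Measure ℝ) [SFinite ν] :
    Measurable fun x : ℝ => ν.bind fun y => kendallPoint α x y := by
  have hk := measurable_kendallPoint α
  refine Measure.measurable_of_measurable_coe _ fun s hs => ?_
  have h : ∀ x, (ν.bind fun y => kendallPoint α x y) s = ∫⁻ y, kendallPoint α x y s ∂ν :=
    fun x => Measure.bind_apply hs (hk.comp measurable_prodMk_left).aemeasurable
  simp_rw [h]
  exact Measurable.lintegral_prod_right' ((Measure.measurable_coe hs).comp hk)

theorem map_neg_pareto (α : ℝ) : (pareto α).map (fun x => -x) = pareto α := by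
  ext s hs
  have hm : Measurable fun x : ℝ => -x := measurable_neg
  rw [Measure.map_apply hm hs, pareto, withDensity_apply _ (hm hs), withDensity_apply _ hs]
  have := (Measure.measurePreserving_neg (volume : Measure ℝ)).setLIntegral_comp_preimage_emb
    (MeasurableEquiv.neg ℝ).measurableEmbedding
    (fun y => ENNReal.ofReal (if 1 ≤ |y| then α * |y| ^ (-2 * α - 1) else 0)) s
  rw [← this]
  simp only [abs_neg]

theorem map_neg_deltaTilde (x : ℝ) : (deltaTilde x).map (fun x => -x) = deltaTilde x := by
  have hm : Measurable fun x : ℝ => -x := measurable_neg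
  rw [deltaTilde, Measure.map_smul, Measure.map_add _ _ hm, Measure.map_dirac' hm,
    Measure.map_dirac' hm, neg_neg, add_comm]

theorem map_mul_abs (μ : Measure ℝ) (h : μ.map (fun x => -x) = μ) (a M : ℝ) :
    (μ.map fun z => M * z).map (fun z => a * z) = μ.map fun z => (|a| * M) * z := by
  rw [Measure.map_map (by fun_prop) (by fun_prop)]
  rcases abs_choice a with ha | ha
  · rw [ha]; congr 1; funext z; simp [mul_assoc]
  · conv_rhs => rw [← h, Measure.map_map (by fun_prop) (by fun_prop)]
    rw [ha]; congr 1; funext z; simp [mul_assoc]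

theorem kendallPoint_mul (α a : ℝ) (ha : a ≠ 0) (x y : ℝ) :
    kendallPoint α (a * x) (a * y) = (kendallPoint α x y).map (fun z => a * z) := by
  have ha' : |a| ≠ 0 := abs_ne_zero.mpr ha
  have hM : max |a * x| |a * y| = |a| * max |x| |y| := by
    rw [abs_mul, abs_mul, mul_max_of_nonneg _ _ (abs_nonneg a)]
  have hm : min |a * x| |a * y| = |a| * min |x| |y| := by
    rw [abs_mul, abs_mul, mul_min_of_nonneg _ _ (abs_nonneg a)]
  have hr : rr (a * x) (a * y) = rr x y := by
    simp only [rr, hM, hm, mul_eq_zero, ha', false_or, mul_div_mul_left _ _ ha']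
  rw [kendallPoint_eq, kendallPoint_eq, hr, hM]
  simp only [mul_eq_zero, ha', false_or]
  split_ifs with h
  · rw [Measure.map_dirac' (by fun_prop), mul_zero]
  · rw [Measure.map_add _ _ (by fun_prop), Measure.map_smul, Measure.map_smul,
      map_mul_abs _ (map_neg_pareto α), map_mul_abs _ (map_neg_deltaTilde 1)]

theorem map_bind' (μ : Measure ℝ) (f : ℝ → Measure ℝ) (hf : Measurable f) (g : ℝ → ℝ)
    (hg : Measurable g) : (μ.bind f).map g = μ.bind fun x => (f x).map g := by
  ext s hs
  have h : Measurable fun x => (f x).map g := (Measure.measurable_map g hg).comp hf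
  rw [Measure.map_apply hg hs, Measure.bind_apply (hg hs) hf.aemeasurable,
    Measure.bind_apply hs h.aemeasurable]
  simp_rw [Measure.map_apply hg hs]

theorem bind_map' (μ : Measure ℝ) (f : ℝ → Measure ℝ) (hf : Measurable f) (g : ℝ → ℝ)
    (hg : Measurable g) : (μ.map g).bind f = μ.bind fun x => f (g x) := by
  ext s hs
  have h : Measurable fun x => f (g x) := hf.comp hg
  rw [Measure.bind_apply hs hf.aemeasurable,
    Measure.bind_apply hs h.aemeasurable]
  exact lintegral_map ((Measure.measurable_coe hs).comp hf) hg

/-- The rescaling operators `T_a` are homomorphisms for the Kendall convolution. -/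
theorem rescale_kendall (α : ℝ) (hα : 0 < α) (a : ℝ)
    (ν₁ ν₂ : Measure ℝ) [IsProbabilityMeasure ν₁] [IsProbabilityMeasure ν₂]
    (h₁ : IsSymmetric ν₁) (h₂ : IsSymmetric ν₂) :
    rescale a (kendall α ν₁ ν₂) = kendall α (rescale a ν₁) (rescale a ν₂) := by
  have hk : ∀ x, Measurable fun y => kendallPoint α x y := fun x =>
    (measurable_kendallPoint α).comp measurable_prodMk_left
  by_cases ha : a = 0
  · simp only [rescale, ha, if_true, kendall]
    rw [Measure.dirac_bind (measurable_bind_kendallPoint α _), Measure.dirac_bind (hk 0),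
      kendallPoint_eq]
    simp
  · have hg : Measurable fun x : ℝ => a * x := by fun_prop
    simp only [rescale, ha, if_false, kendall]
    rw [map_bind' _ _ (measurable_bind_kendallPoint α _) _ hg,
      bind_map' _ _ (measurable_bind_kendallPoint α _) _ hg]
    congr 1
    funext x
    rw [map_bind' _ _ (hk x) _ hg, bind_map' _ _ (hk _) _ hg]
    simp_rw [kendallPoint_mul α a ha]
end

section
/- Let α > 0, let δ̃₁^{▵_α n} denote the n-fold Kendall convolution power of δ̃₁, and let σ be the probability measure on ℝ with density (α/2)|x|^{−2α−1} e^{−|x|^{−α}} (for x ≠ 0) with respect to Lebesgue measure. Then with c_n = n^{−1/α}, the rescaled measures T_{c_n}(δ̃₁^{▵_α n}) converge weakly to σ as n → ∞, and σ ≠ δ₀. -/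
open MeasureTheory

/-- The limit measure `σ` with density `(α/2) |x|^{-2α-1} e^{-|x|^{-α}}`. -/
noncomputable def sigmaKendall (α : ℝ) : Measure ℝ :=
  volume.withDensity fun x =>
    ENNReal.ofReal (α / 2 * |x| ^ (-2 * α - 1) * Real.exp (-|x| ^ (-α)))

open Set Filter

noncomputable def kp (α y : ℝ) : ℝ := if 1 ≤ |y| then α * |y| ^ (-2 * α - 1) else 0

noncomputable def kD (α : ℝ) (n : ℕ) (y : ℝ) : ℝ :=
  ((n + 2) * (n + 1) / 2) * kp α y * (1 - |y| ^ (-α)) ^ n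

lemma kp_nonneg {α : ℝ} (hα : 0 < α) (y : ℝ) : 0 ≤ kp α y := by
  unfold kp; split_ifs <;> positivity

lemma one_sub_nonneg {α : ℝ} (hα : 0 < α) {y : ℝ} (hy : 1 ≤ |y|) : 0 ≤ 1 - |y| ^ (-α) := by
  have := Real.rpow_le_one_of_one_le_of_nonpos hy (by linarith : -α ≤ 0)
  linarith

lemma kD_nonneg {α : ℝ} (hα : 0 < α) (n : ℕ) (y : ℝ) : 0 ≤ kD α n y := by
  unfold kD
  by_cases hy : 1 ≤ |y|
  · have := one_sub_nonneg hα hy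
    have := kp_nonneg hα y
    positivity
  · simp [kp, hy]

@[fun_prop]
lemma measurable_kp (α : ℝ) : Measurable (kp α) := by
  unfold kp
  refine Measurable.ite (measurableSet_le measurable_const (by fun_prop)) (by fun_prop) (by fun_prop)

@[fun_prop]
lemma measurable_kD (α : ℝ) (n : ℕ) : Measurable (kD α n) := by
  unfold kD
  fun_prop

lemma lintegral_even (G : ℝ → ENNReal) :
    ∫⁻ x, G |x| = 2 * ∫⁻ x in Ioi (0 : ℝ), G x := by
  rw [← lintegral_add_compl (fun x => G |x|) (measurableSet_Ioi (a := (0 : ℝ)))]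
  have h1 : ∫⁻ x in Ioi (0 : ℝ), G |x| = ∫⁻ x in Ioi (0 : ℝ), G x :=
    setLIntegral_congr_fun measurableSet_Ioi (fun x hx => by
      rw [abs_of_pos (mem_Ioi.mp hx)])
  have h2 : ∫⁻ x in (Ioi (0 : ℝ))ᶜ, G |x| = ∫⁻ x in Ioi (0 : ℝ), G |x| := by
    rw [compl_Ioi, setLIntegral_congr Iio_ae_eq_Iic.symm]
    have := (Measure.measurePreserving_neg (volume : Measure ℝ)).setLIntegral_comp_preimage_emb
      (Homeomorph.neg ℝ).measurableEmbedding (fun x => G |x|) (Iio 0)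
    simp only [abs_neg, neg_preimage, neg_Iio, neg_zero] at this
    exact this.symm
  rw [h2, h1, two_mul]

lemma integral_part {α : ℝ} (hα : 0 < α) (n : ℕ) {z : ℝ} (hz : 1 ≤ z) :
    ∫⁻ x in Icc 1 z, ENNReal.ofReal (α * x ^ (-α - 1) * (1 - x ^ (-α)) ^ n)
      = ENNReal.ofReal ((1 - z ^ (-α)) ^ (n + 1) / (n + 1)) := by
  have hc : ContinuousOn (fun x : ℝ => α * x ^ (-α - 1) * (1 - x ^ (-α)) ^ n) (Icc 1 z) := by
    have h1 : ∀ r : ℝ, ContinuousOn (fun x : ℝ => x ^ r) (Icc 1 z) := fun r x hx =>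
      (Real.continuousAt_rpow_const _ _ (Or.inl (by linarith [hx.1]))).continuousWithinAt
    exact (continuousOn_const.mul (h1 _)).mul ((continuousOn_const.sub (h1 _)).pow n)
  rw [← ofReal_integral_eq_lintegral_ofReal]
  · congr 1
    rw [integral_Icc_eq_integral_Ioc, ← intervalIntegral.integral_of_le hz]
    rw [intervalIntegral.integral_eq_sub_of_hasDerivAt (f := fun x => (1 - x ^ (-α)) ^ (n + 1) / (n + 1))]
    · simp
    · intro x hx
      rw [uIcc_of_le hz] at hx
      have h0 : x ≠ 0 := by linarith [hx.1]
      have := (((Real.hasDerivAt_rpow_const (x := x) (p := -α) (Or.inl h0)).const_sub 1).pow (n + 1)).div_const ((n : ℝ) + 1)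
      refine this.congr_deriv ?_
      have : (n : ℝ) + 1 ≠ 0 := by positivity
      simp only [Nat.add_sub_cancel]
      push_cast
      field_simp
    · exact (hc.mono (by rw [uIcc_of_le hz])).intervalIntegrable
  · exact hc.integrableOn_Icc
  · filter_upwards [ae_restrict_mem measurableSet_Icc] with x hx
    have hx1 : 1 ≤ |x| := le_trans hx.1 (le_abs_self x)
    have := one_sub_nonneg hα hx1
    rw [abs_of_pos (by linarith [hx.1])] at this
    have : 0 ≤ x := by linarith [hx.1]
    simp only [Pi.zero_apply]
    positivity

lemma inner_lintegral {α : ℝ} (hα : 0 < α) (n : ℕ) (z : ℝ) :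
    ∫⁻ x, ENNReal.ofReal (kD α n x * |x| ^ (-α) * (kp α (z / |x|) / |x|))
      = ENNReal.ofReal ((n + 2) * kp α z * (1 - |z| ^ (-α)) ^ (n + 1)) := by
  have h := lintegral_even
    (fun x => ENNReal.ofReal (kD α n x * |x| ^ (-α) * (kp α (z / |x|) / |x|)))
  have e : ∀ x, kD α n |x| = kD α n x := by intro x; simp [kD, kp]
  simp only [abs_abs, e] at h
  rw [h]
  by_cases hz : 1 ≤ |z|
  · have hz0 : 0 < |z| := by linarith
    have key : ∀ x ∈ Ioi (0 : ℝ), ENNReal.ofReal (kD α n x * |x| ^ (-α) * (kp α (z / |x|) / |x|))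
       = (Icc 1 |z|).indicator (fun x => ENNReal.ofReal ((n + 2) * (n + 1) / 2 * kp α z) *
          ENNReal.ofReal (α * x ^ (-α - 1) * (1 - x ^ (-α)) ^ n)) x := by
      intro x hx
      have hx : 0 < x := hx
      by_cases hm : x ∈ Icc 1 |z|
      · rw [indicator_of_mem hm, ← ENNReal.ofReal_mul (by have := kp_nonneg hα z; positivity)]
        congr 1
        have h1 : 1 ≤ |z| / x := by rw [le_div_iff₀ hx]; linarith [hm.2]
        simp only [kD, kp, abs_of_pos hx, abs_div, hm.1, h1, hz, if_true]
        rw [Real.div_rpow hz0.le hx.le]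
        have h2 : x ^ (-α - 1) = x ^ (-α) / x := by rw [Real.rpow_sub_one hx.ne']
        have h3 : x ^ (-2 * α - 1) ≠ 0 := (Real.rpow_pos_of_pos hx _).ne'
        rw [h2]
        field_simp
      · rw [indicator_of_notMem hm]
        rw [mem_Icc, not_and_or] at hm
        rcases hm with hm | hm
        · simp [kD, kp, abs_of_pos hx, hm]
        · have h1 : ¬ 1 ≤ |z| / x := by rw [le_div_iff₀ hx]; linarith
          simp [kp, abs_of_pos hx, abs_div, h1]
    rw [setLIntegral_congr_fun measurableSet_Ioi key, lintegral_indicator measurableSet_Icc,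
      Measure.restrict_restrict measurableSet_Icc, inter_eq_left.mpr (show Icc 1 |z| ⊆ Ioi 0 from fun x hx => lt_of_lt_of_le one_pos hx.1),
      lintegral_const_mul _ (by fun_prop), integral_part hα n hz,
      ← ENNReal.ofReal_mul (by have := kp_nonneg hα z; positivity),
      show (2 : ENNReal) = ENNReal.ofReal 2 by simp, ← ENNReal.ofReal_mul (by norm_num)]
    congr 1
    field_simp
  · have : kp α z = 0 := by simp [kp, hz]
    rw [this]
    have key : ∀ x ∈ Ioi (0 : ℝ), ENNReal.ofReal (kD α n x * |x| ^ (-α) * (kp α (z / |x|) / |x|)) = 0 := by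
      intro x hx
      have hx : 0 < x := hx
      by_cases h1 : 1 ≤ x
      · have h1 : ¬ 1 ≤ |z| / x := by rw [le_div_iff₀ hx]; linarith
        simp [kp, abs_of_pos hx, abs_div, h1]
      · simp [kD, kp, abs_of_pos hx, h1]
    rw [setLIntegral_congr_fun measurableSet_Ioi key]
    simp

noncomputable def kK (α x : ℝ) : Measure ℝ :=
  ENNReal.ofReal (|x| ^ (-α)) • (pareto α).map (fun y => |x| * y) +
    ENNReal.ofReal (1 - |x| ^ (-α)) • (deltaTilde 1).map (fun y => |x| * y)

lemma pareto_eq (α : ℝ) : pareto α = volume.withDensity (fun y => ENNReal.ofReal (kp α y)) := rfl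

lemma kendallPoint_eq_s8 {α : ℝ} {x y : ℝ} (hx : 1 ≤ |x|) (hy : |y| = 1) :
    kendallPoint α x y = kK α x := by
  have h0 : |x| ≠ 0 := by linarith
  simp only [kendallPoint, hy, max_eq_left hx, min_eq_right hx, h0, if_false, rescale, kK]
  rw [Measure.map_add _ _ (by fun_prop), Measure.map_smul, Measure.map_smul]
  rw [one_div, Real.inv_rpow (abs_nonneg x), Real.rpow_neg (abs_nonneg x)]

instance (x : ℝ) : IsProbabilityMeasure (deltaTilde x) := by
  constructor
  simp [deltaTilde]
  exact ENNReal.inv_two_add_inv_two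

instance inst_s8 (α : ℝ) : SFinite (pareto α) := by
  rw [pareto_eq]; infer_instance

lemma ae_deltaTilde {P : ℝ → Prop} (h1 : P 1) (h2 : P (-1)) : ∀ᵐ y ∂(deltaTilde 1), P y := by
  unfold deltaTilde
  apply Measure.ae_smul_measure
  rw [ae_add_measure_iff]
  simp [ae_dirac_eq, h1, h2]

lemma bind_deltaTilde {α x : ℝ} (hx : 1 ≤ |x|) :
    (deltaTilde 1).bind (fun y => kendallPoint α x y) = kK α x := by
  rw [Measure.bind_congr_right (g := fun _ => kK α x)]
  · simp
  · exact ae_deltaTilde (kendallPoint_eq_s8 hx (by simp)) (kendallPoint_eq_s8 hx (by simp))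

lemma measurable_kK (α : ℝ) : Measurable (kK α) := by
  refine Measure.measurable_of_measurable_coe _ fun s hs => ?_
  have h : ∀ (μ : Measure ℝ) [SFinite μ], Measurable (fun x : ℝ => (μ.map (fun y => |x| * y)) s) := by
    intro μ _
    have h1 : ∀ x : ℝ, (μ.map (fun y => |x| * y)) s
        = μ (Prod.mk x ⁻¹' ((fun q : ℝ × ℝ => |q.1| * q.2) ⁻¹' s)) := by
      intro x
      rw [Measure.map_apply (by fun_prop) hs]
      rfl
    simp only [h1]
    exact measurable_measure_prodMk_left ((by fun_prop : Measurable (fun q : ℝ × ℝ => |q.1| * q.2)) hs)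
  have h1 := h (pareto α)
  have h2 := h (deltaTilde 1)
  simp only [kK, Measure.add_apply, Measure.smul_apply, smul_eq_mul]
  fun_prop

lemma kendall_deltaTilde {α : ℝ} {ν : Measure ℝ} (h : ∀ᵐ x ∂ν, 1 ≤ |x|) :
    kendall α ν (deltaTilde 1) = ν.bind (kK α) := by
  unfold kendall
  apply Measure.bind_congr_right
  filter_upwards [h] with x hx using bind_deltaTilde hx

lemma kK_one {α x : ℝ} (hx : |x| = 1) : kK α x = pareto α := by
  simp [kK, hx]

lemma kendallPow_two {α : ℝ} :
    kendallPow α (deltaTilde 1) 2 = pareto α := by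
  change kendall α (deltaTilde 1) (deltaTilde 1) = _
  rw [kendall_deltaTilde (ae_deltaTilde (by simp) (by simp)),
    Measure.bind_congr_right (g := fun _ => pareto α)]
  · simp
  · exact ae_deltaTilde (kK_one (by simp)) (kK_one (by simp))

lemma lintegral_scale (G : ℝ → ENNReal) (hG : Measurable G) {a : ℝ} (ha : 0 < a) :
    ∫⁻ y, G (a * y) = ∫⁻ z, ENNReal.ofReal a⁻¹ * G z := by
  have h := Real.map_volume_mul_left ha.ne'
  rw [← lintegral_map hG (by fun_prop : Measurable (fun y => a * y)), h,
    lintegral_smul_measure, lintegral_const_mul _ hG, abs_of_pos (by positivity), smul_eq_mul]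

lemma lintegral_kK {α : ℝ} (hα : 0 < α) {x : ℝ} (hx : 1 ≤ |x|) (f : ℝ → ENNReal) (hf : Measurable f) :
    ∫⁻ z, f z ∂(kK α x) =
      (∫⁻ z, ENNReal.ofReal (|x| ^ (-α) * (kp α (z / |x|) / |x|)) * f z)
      + ENNReal.ofReal (1 - |x| ^ (-α)) * (2⁻¹ * (f x + f (-x))) := by
  have h0 : 0 < |x| := by linarith
  unfold kK
  rw [lintegral_add_measure, lintegral_smul_measure, lintegral_smul_measure,
    lintegral_map hf (by fun_prop), lintegral_map hf (by fun_prop)]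
  congr 1
  · rw [pareto_eq, lintegral_withDensity_eq_lintegral_mul _ (by fun_prop) (by fun_prop)]
    have := lintegral_scale (fun z => ENNReal.ofReal (kp α (z / |x|)) * f z) (by fun_prop) h0
    simp only [mul_div_cancel_left₀ _ h0.ne'] at this
    simp only [Pi.mul_apply]
    rw [this, smul_eq_mul, ← lintegral_const_mul _ (by fun_prop)]
    congr 1; ext z
    have := kp_nonneg hα (z / |x|)
    rw [← mul_assoc, ← mul_assoc, ← ENNReal.ofReal_mul (by positivity), ← ENNReal.ofReal_mul (by positivity)]
    congr 2
    field_simp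
  · congr 1
    unfold deltaTilde
    rw [lintegral_smul_measure, lintegral_add_measure, lintegral_dirac' _ (by fun_prop), lintegral_dirac' _ (by fun_prop)]
    rw [smul_eq_mul]
    congr 1
    rcases abs_choice x with h | h <;> rw [h] <;> simp [add_comm]

lemma step {α : ℝ} (hα : 0 < α) (n : ℕ) :
    kendall α (volume.withDensity (fun y => ENNReal.ofReal (kD α n y))) (deltaTilde 1)
      = volume.withDensity (fun y => ENNReal.ofReal (kD α (n + 1) y)) := by
  have hae : ∀ᵐ x ∂(volume.withDensity (fun y => ENNReal.ofReal (kD α n y))), 1 ≤ |x| := by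
    rw [ae_withDensity_iff (by fun_prop)]
    filter_upwards with x hx
    by_contra h
    apply hx
    simp [kD, kp, h]
  rw [kendall_deltaTilde hae]
  refine Measure.ext_of_lintegral _ fun f hf => ?_
  rw [Measure.lintegral_bind (measurable_kK α).aemeasurable hf.aemeasurable]
  rw [lintegral_congr_ae (hae.mono fun x hx => lintegral_kK hα hx f hf)]
  have m1 : Measurable (fun q : ℝ × ℝ => ENNReal.ofReal (|q.1| ^ (-α) * (kp α (q.2 / |q.1|) / |q.1|)) * f q.2) := by
    fun_prop
  have m2 : Measurable (fun x : ℝ => ∫⁻ z, ENNReal.ofReal (|x| ^ (-α) * (kp α (z / |x|) / |x|)) * f z) :=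
    m1.lintegral_prod_right'
  rw [lintegral_add_left m2]
  rw [lintegral_withDensity_eq_lintegral_mul _ (by fun_prop) m2,
    lintegral_withDensity_eq_lintegral_mul _ (by fun_prop) (by fun_prop),
    lintegral_withDensity_eq_lintegral_mul _ (by fun_prop) (by fun_prop)]
  simp only [Pi.mul_apply]
  have A : ∫⁻ x, ENNReal.ofReal (kD α n x) *
      ∫⁻ z, ENNReal.ofReal (|x| ^ (-α) * (kp α (z / |x|) / |x|)) * f z
      = ∫⁻ z, ENNReal.ofReal ((n + 2) * kp α z * (1 - |z| ^ (-α)) ^ (n + 1)) * f z := by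
    calc _ = ∫⁻ x, ∫⁻ z, ENNReal.ofReal (kD α n x * |x| ^ (-α) * (kp α (z / |x|) / |x|)) * f z := by
          congr 1; ext x
          rw [← lintegral_const_mul _ (by fun_prop)]
          congr 1; ext z
          rw [← mul_assoc, ← ENNReal.ofReal_mul (kD_nonneg hα n x), mul_assoc (kD α n x)]
      _ = ∫⁻ z, ∫⁻ x, ENNReal.ofReal (kD α n x * |x| ^ (-α) * (kp α (z / |x|) / |x|)) * f z := by
          apply lintegral_lintegral_swap
          apply Measurable.aemeasurable
          unfold Function.uncurry
          fun_prop
      _ = _ := by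
          congr 1; ext z
          rw [lintegral_mul_const _ (by fun_prop), inner_lintegral hα]
  have B : ∫⁻ x, ENNReal.ofReal (kD α n x) * (ENNReal.ofReal (1 - |x| ^ (-α)) * (2⁻¹ * (f x + f (-x))))
      = ∫⁻ x, ENNReal.ofReal (kD α n x * (1 - |x| ^ (-α))) * f x := by
    let g : ℝ → ENNReal := fun x => ENNReal.ofReal (kD α n x * (1 - |x| ^ (-α))) * f x
    have hg : Measurable g := by fun_prop
    have e : ∀ x, kD α n (-x) = kD α n x := by intro x; simp [kD, kp]
    have h1 : ∫⁻ x, g (-x) = ∫⁻ x, g x :=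
      (Measure.measurePreserving_neg (volume : Measure ℝ)).lintegral_comp hg
    calc _ = ∫⁻ x, 2⁻¹ * (g x + g (-x)) := by
          congr 1; ext x
          simp only [g, e, abs_neg]
          rw [ENNReal.ofReal_mul (kD_nonneg hα n x)]
          ring
      _ = 2⁻¹ * ((∫⁻ x, g x) + ∫⁻ x, g (-x)) := by
          rw [lintegral_const_mul _ (by fun_prop), lintegral_add_left hg]
      _ = ∫⁻ x, g x := by
          rw [h1, ← two_mul, ← mul_assoc, ENNReal.inv_mul_cancel (by simp) (by simp), one_mul]
  rw [A, B, ← lintegral_add_left (by fun_prop)]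
  congr 1; ext z
  rw [← add_mul]
  congr 1
  by_cases hz : 1 ≤ |z|
  · have h1 := one_sub_nonneg hα hz
    have h2 := kp_nonneg hα z
    have h3 := kD_nonneg hα n z
    rw [← ENNReal.ofReal_add (by positivity) (by positivity)]
    congr 1
    simp only [kD]
    push_cast
    ring
  · simp [kD, kp, hz]

lemma kendallPow_eq {α : ℝ} (hα : 0 < α) (n : ℕ) :
    kendallPow α (deltaTilde 1) (n + 2)
      = volume.withDensity (fun y => ENNReal.ofReal (kD α n y)) := by
  induction n with
  | zero =>
    rw [zero_add, kendallPow_two, pareto_eq]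
    simp [kD]
  | succ n ih =>
    change kendall α (kendallPow α (deltaTilde 1) (n + 2)) (deltaTilde 1) = _
    rw [ih, step hα]

noncomputable def kS (α : ℝ) (x : ℝ) : ℝ := α / 2 * |x| ^ (-2 * α - 1) * Real.exp (-|x| ^ (-α))

noncomputable def kB (α : ℝ) (n : ℕ) : ℝ := ((n : ℝ) + 2) ^ (1 / α)

lemma kB_pos (α : ℝ) (n : ℕ) : 0 < kB α n := by unfold kB; positivity

lemma kB_rpow {α : ℝ} (hα : 0 < α) (n : ℕ) {t : ℝ} (ht : 0 ≤ t) :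
    (kB α n * t) ^ (-α) = t ^ (-α) / (n + 2) := by
  rw [Real.mul_rpow (kB_pos α n).le ht]
  unfold kB
  rw [← Real.rpow_mul (by positivity), show 1 / α * -α = -1 by field_simp, Real.rpow_neg_one]
  field_simp

lemma kS_formula {α : ℝ} (hα : 0 < α) (n : ℕ) {x : ℝ} (h1 : 1 ≤ |kB α n * x|) :
    kB α n * kD α n (kB α n * x) = ((n + 1) / (n + 2)) * (α / 2 * |x| ^ (-2 * α - 1)) *
      (1 - |x| ^ (-α) / (n + 2)) ^ n := by
  have hb := kB_pos α n
  simp only [kD, kp, h1, if_true]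
  rw [abs_mul, abs_of_pos hb, kB_rpow hα n (abs_nonneg x), Real.mul_rpow hb.le (abs_nonneg x)]
  have h2 : kB α n ^ (-2 * α - 1) = (kB α n)⁻¹ / (n + 2) ^ 2 := by
    rw [Real.rpow_sub_one hb.ne', show -2 * α = -α * (2 : ℕ) by push_cast; ring, Real.rpow_mul_natCast hb.le]
    have := kB_rpow hα n (zero_le_one)
    rw [mul_one, Real.one_rpow] at this
    rw [this]
    field_simp
  rw [h2]
  field_simp

lemma kS_bound {α : ℝ} (hα : 0 < α) {n : ℕ} (hn : 1 ≤ n) (x : ℝ) :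
    kB α n * kD α n (kB α n * x) ≤ α / 2 * |x| ^ (-2 * α - 1) * Real.exp (-(1 / 3) * |x| ^ (-α)) := by
  by_cases h1 : 1 ≤ |kB α n * x|
  · rw [kS_formula hα n h1]
    have h0 := one_sub_nonneg hα h1
    have hb := kB_pos α n
    rw [abs_mul, abs_of_pos hb, kB_rpow hα n (abs_nonneg x)] at h0
    have hu : 0 ≤ |x| ^ (-α) := by positivity
    set u := |x| ^ (-α)
    have h2 : (1 - u / (n + 2)) ^ n ≤ Real.exp (-(1 / 3) * u) := by
      calc (1 - u / (n + 2)) ^ n ≤ (Real.exp (-(u / (n + 2)))) ^ n := by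
            gcongr
            exact Real.one_sub_le_exp_neg _
        _ = Real.exp (n * -(u / (n + 2))) := by rw [← Real.exp_nat_mul]
        _ ≤ _ := by
          apply Real.exp_le_exp.mpr
          have hn' : (1 : ℝ) ≤ n := by exact_mod_cast hn
          have : (1 / 3 : ℝ) ≤ n / (n + 2) := by
            rw [div_le_div_iff₀ (by norm_num) (by positivity)]; linarith
          have := mul_le_mul_of_nonneg_right this hu
          have e : (n : ℝ) * -(u / (n + 2)) = - (n / (n + 2) * u) := by ring
          rw [e]; linarith
    have h3 : ((n : ℝ) + 1) / (n + 2) ≤ 1 := by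
      rw [div_le_one (by positivity)]; linarith
    have h4 : 0 ≤ α / 2 * |x| ^ (-2 * α - 1) := by positivity
    apply mul_le_mul _ h2 (by positivity) h4
    calc _ ≤ 1 * (α / 2 * |x| ^ (-2 * α - 1)) := by gcongr
      _ = _ := one_mul _
  · have : kD α n (kB α n * x) = 0 := by simp only [kD, kp, h1, if_false, mul_zero, zero_mul]
    rw [this, mul_zero]
    positivity

lemma kS_tendsto {α : ℝ} (hα : 0 < α) {x : ℝ} (hx : x ≠ 0) :
    Tendsto (fun n : ℕ => kB α n * kD α n (kB α n * x)) atTop (nhds (kS α x)) := by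
  have hx0 : 0 < |x| := abs_pos.mpr hx
  set u := |x| ^ (-α) with hu
  have hu0 : 0 < u := by positivity
  have hN : Tendsto (fun n : ℕ => (n : ℝ) + 2) atTop atTop :=
    tendsto_atTop_add_const_right _ _ tendsto_natCast_atTop_atTop
  have hz : Tendsto (fun n : ℕ => u / ((n : ℝ) + 2)) atTop (nhds 0) := hN.const_div_atTop u
  have hev : ∀ᶠ n : ℕ in atTop, 1 ≤ |kB α n * x| ∧ u / ((n : ℝ) + 2) < 1 := by
    filter_upwards [hz.eventually_lt_const one_pos] with n hn
    refine ⟨?_, hn⟩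
    have hb := kB_pos α n
    rw [abs_mul, abs_of_pos hb]
    by_contra h
    push Not at h
    have h2 := Real.one_le_rpow_of_pos_of_le_one_of_nonpos (by positivity : 0 < kB α n * |x|) h.le (by linarith : -α ≤ 0)
    rw [kB_rpow hα n hx0.le] at h2
    linarith
  have hexp : Tendsto (fun n : ℕ => (1 - u / ((n : ℝ) + 2)) ^ (n + 2)) atTop (nhds (Real.exp (-u))) := by
    have := (Real.tendsto_one_add_div_pow_exp (-u)).comp (tendsto_add_atTop_nat 2)
    refine this.congr fun n => ?_
    simp only [Function.comp]
    push_cast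
    ring
  have h1z : Tendsto (fun n : ℕ => 1 - u / ((n : ℝ) + 2)) atTop (nhds 1) := by
    simpa using hz.const_sub 1
  have hpow : Tendsto (fun n : ℕ => (1 - u / ((n : ℝ) + 2)) ^ n) atTop (nhds (Real.exp (-u))) := by
    have := hexp.div (h1z.pow 2) (by norm_num)
    simp only [one_pow, div_one] at this
    refine this.congr' ?_
    filter_upwards [hev] with n hn
    have : 1 - u / ((n : ℝ) + 2) ≠ 0 := by linarith [hn.2]
    simp only [Pi.div_apply]
    rw [pow_add, mul_div_assoc, div_self (by positivity), mul_one]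
  have hr : Tendsto (fun n : ℕ => ((n : ℝ) + 1) / (n + 2)) atTop (nhds 1) := by
    have := (hN.const_div_atTop 1).const_sub 1
    rw [sub_zero] at this
    refine this.congr fun n => ?_
    field_simp
    ring
  have := (hr.mul_const (α / 2 * |x| ^ (-2 * α - 1))).mul hpow
  rw [one_mul] at this
  refine this.congr' ?_
  filter_upwards [hev] with n hn
  rw [kS_formula hα n hn.1]

lemma integrable_even {g : ℝ → ℝ} (hg : Measurable g) (h : IntegrableOn g (Ioi 0)) :
    Integrable (fun x => g |x|) := by
  refine ⟨(hg.comp (by fun_prop : Measurable (fun x : ℝ => |x|))).aestronglyMeasurable, ?_⟩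
  have h2 := h.2
  unfold HasFiniteIntegral at h2 ⊢
  rw [lintegral_even (fun x => ‖g x‖ₑ)]
  exact ENNReal.mul_lt_top (by simp) h2

lemma integrable_bound {α : ℝ} (hα : 0 < α) :
    Integrable (fun x : ℝ => α / 2 * |x| ^ (-2 * α - 1) * Real.exp (-(1 / 3) * |x| ^ (-α))) := by
  apply integrable_even (g := fun x : ℝ => α / 2 * x ^ (-2 * α - 1) * Real.exp (-(1 / 3) * x ^ (-α)))
    (by fun_prop)
  have h := integrableOn_rpow_mul_exp_neg_mul_rpow (p := 1) (s := 1) (b := 1 / 3) (by norm_num) (by norm_num) (by norm_num)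
  rw [← integrableOn_Ioi_comp_rpow_iff' _ (by linarith : -α ≠ 0)] at h
  refine IntegrableOn.congr_fun (h.const_mul (α / 2)) (fun x hx => ?_) measurableSet_Ioi
  have hx : 0 < x := hx
  simp only [Real.rpow_one, smul_eq_mul]
  rw [show -2 * α - 1 = (-α - 1) + -α by ring, Real.rpow_add hx]
  ring

lemma integral_rescale {α : ℝ} (hα : 0 < α) (n : ℕ) (f : BoundedContinuousFunction ℝ ℝ) :
    ∫ x, f x ∂(rescale (((n + 2 : ℕ) : ℝ) ^ (-(1 : ℝ) / α)) (kendallPow α (deltaTilde 1) (n + 2)))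
      = ∫ x, kB α n * kD α n (kB α n * x) * f x := by
  have hb := kB_pos α n
  have hc : ((n + 2 : ℕ) : ℝ) ^ (-(1 : ℝ) / α) = (kB α n)⁻¹ := by
    unfold kB
    rw [neg_div, Real.rpow_neg (by positivity)]
    push_cast
    rfl
  rw [hc, rescale, if_neg (by positivity), kendallPow_eq hα,
    integral_map (by fun_prop) f.continuous.aestronglyMeasurable,
    integral_withDensity_eq_integral_toReal_smul (by fun_prop) (by simp)]
  have := Measure.integral_comp_mul_left (fun x => kD α n (kB α n * x) * f x) (kB α n)⁻¹
  simp only [mul_inv_cancel_left₀ hb.ne', inv_inv, abs_of_pos hb, smul_eq_mul] at this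
  simp only [ENNReal.toReal_ofReal (kD_nonneg hα n _), smul_eq_mul, mul_assoc]
  rw [this, ← integral_const_mul]

lemma integral_sigma {α : ℝ} (hα : 0 < α) (f : BoundedContinuousFunction ℝ ℝ) :
    ∫ x, f x ∂(sigmaKendall α) = ∫ x, kS α x * f x := by
  have h : ∀ x, 0 ≤ kS α x := by intro x; unfold kS; positivity
  have : sigmaKendall α = volume.withDensity (fun x => ENNReal.ofReal (kS α x)) := rfl
  rw [this, integral_withDensity_eq_integral_toReal_smul (by unfold kS; fun_prop) (by simp)]
  simp only [ENNReal.toReal_ofReal (h _), smul_eq_mul]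

lemma main_tendsto {α : ℝ} (hα : 0 < α) (f : BoundedContinuousFunction ℝ ℝ) :
    Tendsto (fun n : ℕ => ∫ x, kB α n * kD α n (kB α n * x) * f x) atTop
      (nhds (∫ x, kS α x * f x)) := by
  apply tendsto_integral_filter_of_dominated_convergence
    (fun x : ℝ => α / 2 * |x| ^ (-2 * α - 1) * Real.exp (-(1 / 3) * |x| ^ (-α)) * ‖f‖)
  · filter_upwards with n
    have := f.continuous.measurable
    exact Measurable.aestronglyMeasurable (by fun_prop)
  · filter_upwards [eventually_ge_atTop 1] with n hn
    filter_upwards with x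
    have h0 : 0 ≤ kB α n * kD α n (kB α n * x) :=
      mul_nonneg (kB_pos α n).le (kD_nonneg hα n _)
    rw [norm_mul, Real.norm_of_nonneg h0]
    exact mul_le_mul (kS_bound hα hn x) (f.norm_coe_le_norm x) (norm_nonneg _) (by positivity)
  · exact (integrable_bound hα).mul_const _
  · have : ∀ᵐ x : ℝ, x ≠ 0 := by
      rw [ae_iff]; simp
    filter_upwards [this] with x hx
    exact (kS_tendsto hα hx).mul_const _

/-- With `c_n = n^{-1/α}`, the rescaled Kendall convolution powers `T_{c_n}(δ̃₁^{▵_α n})`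
converge weakly to `σ ≠ δ₀` (weak convergence stated via integrals of bounded continuous
functions). -/
theorem kendallPow_deltaTilde_tendsto_sigma (α : ℝ) (hα : 0 < α) :
    (∀ f : BoundedContinuousFunction ℝ ℝ,
      Filter.Tendsto
        (fun n : ℕ =>
          ∫ x, f x ∂(rescale ((n : ℝ) ^ (-(1 : ℝ) / α)) (kendallPow α (deltaTilde 1) n)))
        Filter.atTop (nhds (∫ x, f x ∂(sigmaKendall α)))) ∧
    sigmaKendall α ≠ Measure.dirac 0 := by

  constructor
  · intro f
    rw [← tendsto_add_atTop_iff_nat 2, integral_sigma hα]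
    refine (main_tendsto hα f).congr fun n => ?_
    rw [integral_rescale hα]
  · intro h
    have h1 : sigmaKendall α {0} = 0 :=
      withDensity_absolutelyContinuous _ _ (by simp)
    rw [h] at h1
    simp at h1
end

section
/- Let α > 0 and let σ be the measure on ℝ with density (α/2)|x|^{−2α−1} e^{−|x|^{−α}} (for x ≠ 0) with respect to Lebesgue measure. Then σ is a symmetric probability measure, its Williamson transform satisfies ∫_ℝ (1 − |xt|^α)₊ σ(dx) = e^{−|t|^α} for every t ∈ ℝ, and its cumulative distribution function F satisfies F(0) = 1/2, F(t) = (1/2)(1 + t^{−α} + e^{t^{−α}}) e^{−t^{−α}} for t > 0, and F(t) = 1 − F(−t) for t < 0. -/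
open MeasureTheory

/-- The primitive `(1 + x^{-α} - c) e^{-x^{-α}}` on `(0, ∞)`, extended by zero. -/
noncomputable def sigmaPrim (α c x : ℝ) : ℝ :=
  if x ≤ 0 then 0 else (1 + x ^ (-α) - c) * Real.exp (-x ^ (-α))

/-- Its derivative. -/
noncomputable def sigmaDer (α c x : ℝ) : ℝ :=
  α * (1 - c * x ^ α) * x ^ (-2 * α - 1) * Real.exp (-x ^ (-α))

lemma sigmaPrim_hasDerivAt (α c x : ℝ) (hx : 0 < x) :
    HasDerivAt (sigmaPrim α c) (sigmaDer α c x) x := by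
  have h1 : HasDerivAt (fun x : ℝ => x ^ (-α)) (-α * x ^ (-α - 1)) x :=
    Real.hasDerivAt_rpow_const (Or.inl hx.ne')
  have h2 := ((h1.const_add 1).sub_const c).mul h1.neg.exp
  have h3 : sigmaPrim α c =ᶠ[nhds x]
      fun x => (1 + x ^ (-α) - c) * Real.exp (-x ^ (-α)) := by
    filter_upwards [lt_mem_nhds hx] with y hy
    simp [sigmaPrim, not_le.mpr hy]
  refine HasDerivAt.congr_of_eventuallyEq ?_ h3
  refine h2.congr_deriv ?_
  have e1 : x ^ (-2 * α - 1) = x ^ (-α - 1) * x ^ (-α) := by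
    rw [← Real.rpow_add hx]; ring_nf
  have e2 : x ^ α * x ^ (-α) = 1 := by
    rw [← Real.rpow_add hx]; simp
  simp only [sigmaDer, e1, Pi.neg_apply]
  linear_combination (α * c * x ^ (-α - 1) * Real.exp (-x ^ (-α))) * e2

lemma sigmaPrim_tendsto_zero (α c : ℝ) (hα : 0 < α) :
    ContinuousWithinAt (sigmaPrim α c) (Set.Ici 0) 0 := by
  rw [← continuousWithinAt_Ioi_iff_Ici]
  have h0 : sigmaPrim α c 0 = 0 := by simp [sigmaPrim]
  rw [ContinuousWithinAt, h0]
  have ht : Filter.Tendsto (fun x : ℝ => x ^ (-α)) (nhdsWithin 0 (Set.Ioi 0)) Filter.atTop :=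
    tendsto_rpow_neg_nhdsGT_zero (neg_lt_zero.2 hα)
  have hg : Filter.Tendsto (fun s : ℝ => (1 + s - c) * Real.exp (-s)) Filter.atTop (nhds 0) := by
    have a := Real.tendsto_pow_mul_exp_neg_atTop_nhds_zero 1
    have b := (Real.tendsto_pow_mul_exp_neg_atTop_nhds_zero 0).const_mul (1 - c)
    have := a.add b
    simp only [mul_zero, add_zero] at this
    refine this.congr fun s => ?_
    ring
  refine (hg.comp ht).congr' ?_
  filter_upwards [self_mem_nhdsWithin] with x hx
  simp [sigmaPrim, not_le.mpr (Set.mem_Ioi.mp hx)]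

lemma sigmaDer_nonneg (α c x : ℝ) (hα : 0 < α) (hx : 0 < x) (h : c * x ^ α ≤ 1) :
    0 ≤ sigmaDer α c x := by
  have : 0 ≤ 1 - c * x ^ α := by linarith
  unfold sigmaDer
  positivity

lemma sigmaPrim_continuousOn (α c b : ℝ) (hα : 0 < α) :
    ContinuousOn (sigmaPrim α c) (Set.Icc 0 b) := by
  intro x hx
  rcases hx.1.eq_or_lt with h | h
  · subst h
    exact (sigmaPrim_tendsto_zero α c hα).mono Set.Icc_subset_Ici_self
  · exact (sigmaPrim_hasDerivAt α c x h).continuousAt.continuousWithinAt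

lemma sigmaDer_integral (α c b : ℝ) (hα : 0 < α) (hc : 0 ≤ c) (hb : 0 < b)
    (h : c * b ^ α ≤ 1) :
    IntegrableOn (sigmaDer α c) (Set.Ioc 0 b) ∧
    ∫ x in Set.Ioc 0 b, sigmaDer α c x = (1 + b ^ (-α) - c) * Real.exp (-b ^ (-α)) := by
  have hcont := sigmaPrim_continuousOn α c b hα
  have hd : ∀ x ∈ Set.Ioo 0 b, HasDerivAt (sigmaPrim α c) (sigmaDer α c x) x :=
    fun x hx => sigmaPrim_hasDerivAt α c x hx.1
  have hi : IntegrableOn (sigmaDer α c) (Set.Ioc 0 b) := by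
    refine intervalIntegral.integrableOn_deriv_of_nonneg hcont hd ?_
    intro x hx
    refine sigmaDer_nonneg α c x hα hx.1 (le_trans ?_ h)
    exact mul_le_mul_of_nonneg_left (Real.rpow_le_rpow hx.1.le hx.2.le hα.le) hc
  refine ⟨hi, ?_⟩
  have := intervalIntegral.integral_eq_sub_of_hasDerivAt_of_le hb.le hcont hd
    ((intervalIntegrable_iff_integrableOn_Ioc_of_le hb.le).2 hi)
  rw [intervalIntegral.integral_of_le hb.le] at this
  rw [this]
  simp [sigmaPrim, not_le.mpr hb]

lemma sigmaDer_integral_Ioi (α : ℝ) (hα : 0 < α) :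
    IntegrableOn (sigmaDer α 0) (Set.Ioi 0) ∧
    ∫ x in Set.Ioi 0, sigmaDer α 0 x = 1 := by
  have ht : Filter.Tendsto (sigmaPrim α 0) Filter.atTop (nhds 1) := by
    have h := tendsto_rpow_neg_atTop hα
    have h2 := ((h.const_add 1).sub_const 0).mul (Real.continuous_exp.tendsto _ |>.comp h.neg)
    simp only [neg_zero, Real.exp_zero, add_zero, sub_zero, mul_one] at h2
    refine h2.congr' ?_
    filter_upwards [Filter.eventually_gt_atTop 0] with x hx
    simp [sigmaPrim, not_le.mpr hx]
  have hc := sigmaPrim_tendsto_zero α 0 hα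
  have hd : ∀ x ∈ Set.Ioi (0:ℝ), HasDerivAt (sigmaPrim α 0) (sigmaDer α 0 x) x :=
    fun x hx => sigmaPrim_hasDerivAt α 0 x hx
  have hn : ∀ x ∈ Set.Ioi (0:ℝ), 0 ≤ sigmaDer α 0 x :=
    fun x hx => sigmaDer_nonneg α 0 x hα hx (by simp)
  refine ⟨integrableOn_Ioi_deriv_of_nonneg hc hd hn ht, ?_⟩
  rw [integral_Ioi_of_hasDerivAt_of_nonneg hc hd hn ht]
  simp [sigmaPrim]

lemma sigmaDer_integrable_abs (α : ℝ) (hα : 0 < α) :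
    Integrable (fun x : ℝ => sigmaDer α 0 |x|) := by
  by_contra h
  have h1 := integral_undef h
  rw [integral_comp_abs, (sigmaDer_integral_Ioi α hα).2] at h1
  norm_num at h1

lemma sigmaKendall_eq (α : ℝ) : sigmaKendall α =
    volume.withDensity fun x => ENNReal.ofReal (1 / 2 * sigmaDer α 0 |x|) := by
  unfold sigmaKendall sigmaDer
  congr 1
  ext x
  congr 1
  ring

lemma sigmaDer_abs_nonneg (α x : ℝ) (hα : 0 < α) : 0 ≤ 1 / 2 * sigmaDer α 0 |x| := by
  unfold sigmaDer
  simp only [zero_mul, sub_zero]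
  positivity

lemma sigmaDer_measurable (α c : ℝ) : Measurable (sigmaDer α c) := by
  unfold sigmaDer
  fun_prop

lemma sigmaKendall_prob (α : ℝ) (hα : 0 < α) : IsProbabilityMeasure (sigmaKendall α) := by
  have hI := sigmaDer_integral_Ioi α hα
  have hint : Integrable (fun x : ℝ => 1 / 2 * sigmaDer α 0 |x|) :=
    (sigmaDer_integrable_abs α hα).const_mul _
  constructor
  rw [sigmaKendall_eq, withDensity_apply _ MeasurableSet.univ, Measure.restrict_univ,
    ← ofReal_integral_eq_lintegral_ofReal hint
      (Filter.Eventually.of_forall fun x => sigmaDer_abs_nonneg α x hα),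
    integral_const_mul, integral_comp_abs, hI.2]
  norm_num

lemma sigmaKendall_symm (α : ℝ) : IsSymmetric (sigmaKendall α) := by
  unfold IsSymmetric
  rw [sigmaKendall_eq]
  have hm : Measurable fun x : ℝ => ENNReal.ofReal (1 / 2 * sigmaDer α 0 |x|) := by
    have := sigmaDer_measurable α 0
    fun_prop
  ext s hs
  rw [Measure.map_apply measurable_neg hs, withDensity_apply _ (measurable_neg hs),
    withDensity_apply _ hs]
  rw [← (Measure.measurePreserving_neg (volume : Measure ℝ)).setLIntegral_comp_preimage hs hm]
  simp

lemma sigmaKendall_williamson (α : ℝ) (hα : 0 < α) (t : ℝ) :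
    ∫ x, max (1 - |x * t| ^ α) 0 ∂(sigmaKendall α) = Real.exp (-|t| ^ α) := by
  have := sigmaKendall_prob α hα
  rcases eq_or_ne t 0 with rfl | ht
  · simp [Real.zero_rpow hα.ne']
  have hm : Measurable fun x : ℝ => ENNReal.ofReal (1 / 2 * sigmaDer α 0 |x|) := by
    have := sigmaDer_measurable α 0
    fun_prop
  have htp : 0 < |t| := abs_pos.2 ht
  have hb : 0 < |t|⁻¹ := inv_pos.2 htp
  rw [sigmaKendall_eq, integral_withDensity_eq_integral_toReal_smul hm
    (Filter.Eventually.of_forall fun x => ENNReal.ofReal_lt_top)]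
  have e1 : ∀ x : ℝ, (ENNReal.ofReal (1 / 2 * sigmaDer α 0 |x|)).toReal •
      max (1 - |x * t| ^ α) 0 =
      (fun y => 1 / 2 * (sigmaDer α 0 y * max (1 - (y * |t|) ^ α) 0)) |x| := by
    intro x
    rw [ENNReal.toReal_ofReal (sigmaDer_abs_nonneg α x hα), abs_mul]
    simp only [smul_eq_mul]
    ring
  rw [integral_congr_ae (Filter.Eventually.of_forall e1),
    integral_comp_abs (f := fun y => 1 / 2 * (sigmaDer α 0 y * max (1 - (y * |t|) ^ α) 0)),
    integral_const_mul,
    setIntegral_eq_of_subset_of_forall_sdiff_eq_zero measurableSet_Ioi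
      (Set.Ioc_subset_Ioi_self : Set.Ioc 0 |t|⁻¹ ⊆ Set.Ioi 0)]
  · have e2 : ∫ y in Set.Ioc 0 |t|⁻¹, sigmaDer α 0 y * max (1 - (y * |t|) ^ α) 0 =
        ∫ y in Set.Ioc 0 |t|⁻¹, sigmaDer α (|t| ^ α) y := by
      refine setIntegral_congr_fun measurableSet_Ioc fun y hy => ?_
      have h1 : (y * |t|) ^ α ≤ 1 := by
        refine Real.rpow_le_one (by have := hy.1.le; positivity) ?_ hα.le
        calc y * |t| ≤ |t|⁻¹ * |t| := mul_le_mul_of_nonneg_right hy.2 htp.le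
          _ = 1 := inv_mul_cancel₀ htp.ne'
      rw [max_eq_left (by linarith), Real.mul_rpow hy.1.le htp.le]
      unfold sigmaDer
      ring
    have h3 : |t| ^ α * |t|⁻¹ ^ α = 1 := by
      rw [← Real.mul_rpow htp.le hb.le, mul_inv_cancel₀ htp.ne', Real.one_rpow]
    rw [e2, (sigmaDer_integral α (|t| ^ α) |t|⁻¹ hα (by positivity) hb h3.le).2]
    have h4 : |t|⁻¹ ^ (-α) = |t| ^ α := by
      rw [Real.inv_rpow htp.le, Real.rpow_neg htp.le, inv_inv]
    rw [h4]
    ring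
  · intro y hy
    have hy0 : 0 < y := hy.1
    have hy1 : |t|⁻¹ < y := by
      by_contra hh
      exact hy.2 ⟨hy0, not_lt.mp hh⟩
    have h1 : 1 ≤ (y * |t|) ^ α := by
      refine Real.one_le_rpow ?_ hα.le
      calc (1:ℝ) = |t|⁻¹ * |t| := (inv_mul_cancel₀ htp.ne').symm
        _ ≤ y * |t| := mul_le_mul_of_nonneg_right hy1.le htp.le
    rw [max_eq_right (by linarith), mul_zero]

lemma sigmaKendall_neg (α t : ℝ) (hα : 0 < α) :
    (sigmaKendall α).real (Set.Iic t) = 1 - (sigmaKendall α).real (Set.Iic (-t)) := by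
  have := sigmaKendall_prob α hα
  have : NullSingletonClass (sigmaKendall α) :=
    ⟨fun x => withDensity_absolutelyContinuous _ _ (measure_singleton x)⟩
  have h : (sigmaKendall α).real (Set.Iic t) = (sigmaKendall α).real (Set.Ioi (-t)) := by
    have hs : (sigmaKendall α).map (fun x => -x) = sigmaKendall α := sigmaKendall_symm α
    unfold Measure.real
    congr 1
    rw [measure_congr (Ioi_ae_eq_Ici (a := -t) (μ := sigmaKendall α))]
    conv_lhs => rw [← hs]
    rw [Measure.map_apply measurable_neg measurableSet_Iic]
    congr 1
    ext x
    simp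
  rw [h, ← Set.compl_Iic, probReal_compl_eq_one_sub measurableSet_Iic]

lemma sigmaKendall_zero (α : ℝ) (hα : 0 < α) :
    (sigmaKendall α).real (Set.Iic 0) = 1 / 2 := by
  have := sigmaKendall_neg α 0 hα
  rw [neg_zero] at this
  linarith

lemma sigmaKendall_pos (α t : ℝ) (hα : 0 < α) (ht : 0 < t) :
    (sigmaKendall α).real (Set.Iic t) =
      (1 / 2) * (1 + t ^ (-α) + Real.exp (t ^ (-α))) * Real.exp (-t ^ (-α)) := by
  have := sigmaKendall_prob α hα
  have hI := sigmaDer_integral α 0 t hα le_rfl ht (by simp)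
  have hu : Set.Iic t = Set.Iic 0 ∪ Set.Ioc 0 t := (Set.Iic_union_Ioc_eq_Iic ht.le).symm
  have hd : Disjoint (Set.Iic (0:ℝ)) (Set.Ioc 0 t) := by
    rw [Set.disjoint_left]
    intro x hx hx'
    exact absurd hx'.1 (not_lt.mpr hx)
  rw [hu, measureReal_union hd measurableSet_Ioc, sigmaKendall_zero α hα]
  have e : (sigmaKendall α).real (Set.Ioc 0 t) =
      1 / 2 * ((1 + t ^ (-α) - 0) * Real.exp (-t ^ (-α))) := by
    have hc : ∫ x in Set.Ioc 0 t, 1 / 2 * sigmaDer α 0 |x| =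
        ∫ x in Set.Ioc 0 t, 1 / 2 * sigmaDer α 0 x :=
      setIntegral_congr_fun measurableSet_Ioc fun x hx => by simp only [abs_of_pos hx.1]
    have hint : IntegrableOn (fun x : ℝ => 1 / 2 * sigmaDer α 0 |x|) (Set.Ioc 0 t) :=
      (((sigmaDer_integrable_abs α hα).const_mul _)).integrableOn
    rw [Measure.real, sigmaKendall_eq, withDensity_apply _ measurableSet_Ioc,
      ← ofReal_integral_eq_lintegral_ofReal hint
        (Filter.Eventually.of_forall fun x => sigmaDer_abs_nonneg α x hα),
      ENNReal.toReal_ofReal (integral_nonneg fun x => sigmaDer_abs_nonneg α x hα), hc,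
      integral_const_mul, hI.2]
  have h1 : Real.exp (t ^ (-α)) * Real.exp (-t ^ (-α)) = 1 := by
    rw [← Real.exp_add]; simp
  rw [e]
  linear_combination (-1 / 2 : ℝ) * h1

/-- `σ` is a symmetric probability measure, its Williamson transform is `e^{-|t|^α}`, and
its CDF satisfies `F(0) = 1/2`, `F(t) = (1/2)(1 + t^{-α} + e^{t^{-α}}) e^{-t^{-α}}` for
`t > 0` and `F(t) = 1 - F(-t)` for `t < 0`. -/
theorem sigmaKendall_properties (α : ℝ) (hα : 0 < α) :
    IsProbabilityMeasure (sigmaKendall α) ∧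
    IsSymmetric (sigmaKendall α) ∧
    (∀ t : ℝ, ∫ x, max (1 - |x * t| ^ α) 0 ∂(sigmaKendall α) = Real.exp (-|t| ^ α)) ∧
    ((sigmaKendall α) (Set.Iic 0)).toReal = 1 / 2 ∧
    (∀ t : ℝ, 0 < t → ((sigmaKendall α) (Set.Iic t)).toReal =
      (1 / 2) * (1 + t ^ (-α) + Real.exp (t ^ (-α))) * Real.exp (-t ^ (-α))) ∧
    (∀ t : ℝ, t < 0 → ((sigmaKendall α) (Set.Iic t)).toReal =
      1 - ((sigmaKendall α) (Set.Iic (-t))).toReal) := by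
  exact ⟨sigmaKendall_prob α hα, sigmaKendall_symm α, sigmaKendall_williamson α hα,
    sigmaKendall_zero α hα, fun t ht => sigmaKendall_pos α t hα ht,
    fun t _ => sigmaKendall_neg α t hα⟩
end
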